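/- arXiv:math/0406110 — 5 statements merged into one kernel-verified Lean document; each statement's English description precedes it below -/
import Mathlib

section
/- For every integer n ≥ 1 and for Lebesgue-almost every choice of left ends x₁ < … < x_{n−1} in ℝ and lengths λ₁ < … < λ_n in (0,∞), the total hit count N(x₁,…,x_{n−1}; λ₁,…,λ_n) := Σ_{π ∈ S_n} N_π(x₁,…,x_{n−1}; λ₁,…,λ_n) equals n! (where each location X is counted with its multiplicity, i.e. once for each permutation π for which it produces an X-hit). -/
open MeasureTheory

/-- Extend a `Fin n`-tuple of reals to `ℕ` by zero (junk values beyond `n`). -/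
noncomputable def natExt {n : ℕ} (f : Fin n → ℝ) : ℕ → ℝ :=
  fun k => if h : k < n then f ⟨k, h⟩ else 0

/-- The Lindley recursion: `z 0 = w 0`, `z (k+1) = max (z k + l k) (w (k+1))`.
These are the left ends of the rods after the resolution of conflicts, for a
configuration whose (sorted) left ends are `w` and whose lengths are `l`. -/
noncomputable def lindleyNat (w l : ℕ → ℝ) : ℕ → ℝ
  | 0 => w 0
  | k + 1 => max (lindleyNat w l k + l k) (w (k + 1))

/-- Left ends of the r-configuration obtained by resolving conflicts of the sorted
configuration with left ends `w` and lengths `l`. -/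
noncomputable def resolve {n : ℕ} (w l : Fin n → ℝ) : Fin n → ℝ :=
  fun i => lindleyNat (natExt w) (natExt l) i

/-- `IsXHit p l m` : placing rods of lengths `l i` with left ends `p i` and resolving
the conflicts (after sorting the left ends), the resulting r-configuration has a hit of
the origin (some right end `z k + l k` equals `0`) whose cluster is rooted at the rod
which was originally placed at position index `m` (the root of the cluster containing
rod `k` is the largest index `r ≤ k` whose resolved left end coincides with its original
left end). -/
def IsXHit {n : ℕ} (p l : Fin n → ℝ) (m : Fin n) : Prop :=
  ∃ k r : Fin n, r ≤ k ∧
    resolve (p ∘ Tuple.sort p) (l ∘ Tuple.sort p) k + (l ∘ Tuple.sort p) k = 0 ∧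
    resolve (p ∘ Tuple.sort p) (l ∘ Tuple.sort p) r = (p ∘ Tuple.sort p) r ∧
    (∀ i : Fin n, r < i → i ≤ k →
      resolve (p ∘ Tuple.sort p) (l ∘ Tuple.sort p) i ≠ (p ∘ Tuple.sort p) i) ∧
    Tuple.sort p r = m

open Finset

lemma natExt_apply {n : ℕ} (f : Fin n → ℝ) (i : Fin n) : natExt f i = f i := by
  simp [natExt]

lemma natExt_of_lt {n : ℕ} (f : Fin n → ℝ) {i : ℕ} (h : i < n) : natExt f i = f ⟨i, h⟩ := by
  simp [natExt, h]

/-- A resolved left end is the maximum of the positions to which the rods on its left push it. -/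
lemma lindleyNat_le_iff (w l : ℕ → ℝ) (k : ℕ) (c : ℝ) :
    lindleyNat w l k ≤ c ↔ ∀ i ≤ k, w i + ∑ t ∈ Ico i k, l t ≤ c := by
  induction k generalizing c with
  | zero => simp [lindleyNat]
  | succ k ih =>
    rw [lindleyNat, max_le_iff, ← le_sub_iff_add_le, ih]
    constructor
    · rintro ⟨h1, h2⟩ i hi
      rcases Nat.lt_or_ge k i with h | h
      · obtain rfl : i = k + 1 := by omega
        simpa using h2
      · rw [sum_Ico_succ_top h]
        linarith [h1 i h]
    · intro h
      refine ⟨fun i hi => ?_, by simpa using h (k + 1) le_rfl⟩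
      have := h i (by omega)
      rw [sum_Ico_succ_top hi] at this
      linarith

lemma le_lindleyNat (w l : ℕ → ℝ) (k : ℕ) : w k ≤ lindleyNat w l k := by
  cases k with
  | zero => exact le_rfl
  | succ k => exact le_max_right _ _

lemma lindleyNat_eq_left_iff (w l : ℕ → ℝ) (j : ℕ) :
    lindleyNat w l j = w j ↔ ∀ i < j, w i + ∑ t ∈ Ico i j, l t ≤ w j := by
  rw [← (le_lindleyNat w l j).ge_iff_eq', lindleyNat_le_iff]
  refine ⟨fun h i hi => h i hi.le, fun h i hi => ?_⟩
  rcases hi.lt_or_eq with h' | rfl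
  · exact h i h'
  · simp

lemma lindleyNat_add_of_ne (w l : ℕ → ℝ) {j k : ℕ} (hjk : j ≤ k) (hj : lindleyNat w l j = w j)
    (h : ∀ i, j < i → i ≤ k → lindleyNat w l i ≠ w i) :
    lindleyNat w l k = w j + ∑ t ∈ Ico j k, l t := by
  induction k, hjk using Nat.le_induction with
  | base => simpa using hj
  | succ k hk ih =>
    have h1 := h (k + 1) (by omega) le_rfl
    rw [sum_Ico_succ_top hk, ← add_assoc, ← ih fun i hi hi' => h i hi (by omega)]
    rw [lindleyNat] at h1 ⊢
    rcases max_choice (lindleyNat w l k + l k) (w (k + 1)) with h2 | h2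
    · exact h2
    · exact absurd h2 h1

lemma lindleyNat_ne_iff (w l : ℕ → ℝ) {j k : ℕ} (hj : lindleyNat w l j = w j) :
    (∀ i, j < i → i ≤ k → lindleyNat w l i ≠ w i) ↔
      ∀ i, j < i → i ≤ k → w i < w j + ∑ t ∈ Ico j i, l t := by
  constructor
  · intro h i hi hik
    rw [← lindleyNat_add_of_ne w l hi.le hj fun i' h1 h2 => h i' h1 (by omega)]
    exact lt_of_le_of_ne (le_lindleyNat w l i) (h i hi hik).symm
  · intro h i hi hik
    have h1 := (lindleyNat_le_iff w l i _).1 le_rfl j hi.le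
    exact ((h i hi hik).trans_le h1).ne'

/-- The cluster rooted at `j` has its `k`-th right end at the origin. -/
lemma lindleyNat_hit_iff (w l : ℕ → ℝ) {j k : ℕ} (hjk : j ≤ k) :
    (lindleyNat w l k + l k = 0 ∧ lindleyNat w l j = w j ∧
        ∀ i, j < i → i ≤ k → lindleyNat w l i ≠ w i) ↔
      w j + ∑ t ∈ Ico j (k + 1), l t = 0 ∧
        (∀ i < j, w i + ∑ t ∈ Ico i (k + 1), l t ≤ 0) ∧
        ∀ i, j < i → i ≤ k → w i + ∑ t ∈ Ico i (k + 1), l t < 0 := by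
  have e (i m : ℕ) (h1 : i ≤ m) (h2 : m ≤ k + 1) :
      ∑ t ∈ Ico i (k + 1), l t = ∑ t ∈ Ico i m, l t + ∑ t ∈ Ico m (k + 1), l t :=
    (sum_Ico_consecutive _ h1 h2).symm
  constructor
  · rintro ⟨h1, h2, h3⟩
    have h4 := lindleyNat_add_of_ne w l hjk h2 h3
    have h0 : w j + ∑ t ∈ Ico j (k + 1), l t = 0 := by
      rw [sum_Ico_succ_top hjk]
      linarith
    refine ⟨h0, fun i hi => ?_, fun i hi hik => ?_⟩
    · have := (lindleyNat_eq_left_iff w l j).1 h2 i hi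
      rw [e i j hi.le (by omega)]
      linarith
    · have := (lindleyNat_ne_iff w l h2).1 h3 i hi hik
      rw [e j i hi.le (by omega)] at h0
      linarith
  · rintro ⟨h0, h1, h2⟩
    have h3 : lindleyNat w l j = w j := by
      rw [lindleyNat_eq_left_iff]
      intro i hi
      have := h1 i hi
      rw [e i j hi.le (by omega)] at this
      linarith
    have h4 : ∀ i, j < i → i ≤ k → lindleyNat w l i ≠ w i := by
      rw [lindleyNat_ne_iff w l h3]
      intro i hi hik
      have := h2 i hi hik
      rw [e j i hi.le (by omega)] at h0
      linarith
    refine ⟨?_, h3, h4⟩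
    rw [lindleyNat_add_of_ne w l hjk h3 h4]
    rw [sum_Ico_succ_top hjk] at h0
    linarith

/-- The permutation moving the last entry of an `(n + 1)`-tuple to place `j`. -/
def insertPerm {n : ℕ} (j : Fin (n + 1)) : Equiv.Perm (Fin (n + 1)) :=
  (finSuccEquiv' j).trans (finSuccEquiv' (Fin.last n)).symm

lemma insertPerm_self {n : ℕ} (j : Fin (n + 1)) : insertPerm j j = Fin.last n := by
  simp [insertPerm]

lemma insertPerm_succAbove {n : ℕ} (j : Fin (n + 1)) (i : Fin n) :
    insertPerm j (j.succAbove i) = i.castSucc := by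
  simp [insertPerm]

lemma snoc_comp_insertPerm {n : ℕ} (x : Fin n → ℝ) (X : ℝ) (j : Fin (n + 1)) :
    (Fin.snoc x X : Fin (n + 1) → ℝ) ∘ insertPerm j = j.insertNth X x := by
  ext i
  induction i using Fin.succAboveCases j with
  | x => simp [insertPerm_self]
  | p i => simp [insertPerm_succAbove]

lemma strictMono_insertNth {n : ℕ} {x : Fin n → ℝ} (hx : StrictMono x) {X : ℝ}
    {j : Fin (n + 1)} (hX : ∀ i, X ≠ x i) (hj : ∀ i : Fin n, x i < X ↔ i.castSucc < j) :
    StrictMono (j.insertNth X x : Fin (n + 1) → ℝ) := by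
  intro a b hab
  induction a using Fin.succAboveCases j with
  | x =>
    induction b using Fin.succAboveCases j with
    | x => exact absurd hab (lt_irrefl _)
    | p b =>
      have h1 : ¬ b.castSucc < j := fun h => by
        rw [Fin.succAbove_of_castSucc_lt _ _ h] at hab
        exact absurd hab h.not_gt
      simpa using lt_of_le_of_ne (not_lt.1 (mt (hj b).1 h1)) (hX b)
  | p a =>
    induction b using Fin.succAboveCases j with
    | x =>
      have h1 : a.castSucc < j := by
        by_contra h
        rw [Fin.succAbove_of_le_castSucc _ _ (not_lt.1 h)] at hab
        exact h (Fin.castSucc_lt_succ.trans hab)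
      simpa using (hj a).2 h1
    | p b => simpa using hx (Fin.succAbove_lt_succAbove_iff.1 hab)

lemma sort_snoc {n : ℕ} {x : Fin n → ℝ} (hx : StrictMono x) {X : ℝ}
    {j : Fin (n + 1)} (hX : ∀ i, X ≠ x i) (hj : ∀ i : Fin n, x i < X ↔ i.castSucc < j) :
    Tuple.sort (Fin.snoc x X : Fin (n + 1) → ℝ) = insertPerm j := by
  symm
  have h := strictMono_insertNth hx hX hj
  rw [← snoc_comp_insertPerm] at h
  rw [Tuple.eq_sort_iff]
  exact ⟨h.monotone, fun a b hab e => absurd (h hab) (by simp only [Function.comp]; exact e.not_lt)⟩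

lemma natExt_insertNth_of_lt {n : ℕ} (x : Fin n → ℝ) (X : ℝ) (j : Fin (n + 1)) {i : ℕ}
    (h : i < j) : natExt (j.insertNth X x : Fin (n + 1) → ℝ) i = natExt x i := by
  have hi : i < n := by omega
  have := Fin.insertNth_apply_succAbove (α := fun _ => ℝ) j X x ⟨i, hi⟩
  rw [Fin.succAbove_of_castSucc_lt _ _ (by simpa [Fin.lt_def] using h)] at this
  rw [natExt_of_lt x hi, natExt_of_lt _ (by omega : i < n + 1), ← this]
  rfl

lemma natExt_insertNth_succ {n : ℕ} (x : Fin n → ℝ) (X : ℝ) (j : Fin (n + 1)) {i : ℕ}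
    (h : j ≤ i) (hi : i < n) :
    natExt (j.insertNth X x : Fin (n + 1) → ℝ) (i + 1) = natExt x i := by
  have := Fin.insertNth_apply_succAbove (α := fun _ => ℝ) j X x ⟨i, hi⟩
  rw [Fin.succAbove_of_le_castSucc _ _ (by simpa [Fin.le_def] using h)] at this
  rw [natExt_of_lt x hi, natExt_of_lt _ (by omega : i + 1 < n + 1), ← this]
  rfl

/-- A free rod placed at `X`, of rank `j` among the left ends, produces an `X`-hit. -/
lemma isXHit_snoc_iff {n : ℕ} {x : Fin n → ℝ} (hx : StrictMono x) {X : ℝ}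
    {j : Fin (n + 1)} (hX : ∀ i, X ≠ x i) (hj : ∀ i : Fin n, x i < X ↔ i.castSucc < j)
    (l : Fin (n + 1) → ℝ) :
    IsXHit (Fin.snoc x X) l (Fin.last n) ↔ ∃ k : Fin (n + 1), j ≤ k ∧
      X + ∑ t ∈ Ico (j : ℕ) (k + 1), natExt (l ∘ insertPerm j) t = 0 ∧
      (∀ i < (j : ℕ), natExt x i + ∑ t ∈ Ico i (k + 1), natExt (l ∘ insertPerm j) t ≤ 0) ∧
      ∀ i, (j : ℕ) ≤ i → i < k →
        natExt x i + ∑ t ∈ Ico (i + 1) (k + 1), natExt (l ∘ insertPerm j) t < 0 := by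
  unfold IsXHit
  rw [sort_snoc hx hX hj, snoc_comp_insertPerm]
  set w : Fin (n + 1) → ℝ := j.insertNth X x with hw
  set m := l ∘ insertPerm j
  have key (k : Fin (n + 1)) (hk : j ≤ k) : (resolve w m k + m k = 0 ∧ resolve w m j = w j ∧
      (∀ i : Fin (n + 1), j < i → i ≤ k → resolve w m i ≠ w i)) ↔
      X + ∑ t ∈ Ico (j : ℕ) (k + 1), natExt m t = 0 ∧
      (∀ i < (j : ℕ), natExt x i + ∑ t ∈ Ico i (k + 1), natExt m t ≤ 0) ∧
      ∀ i, (j : ℕ) ≤ i → i < k →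
        natExt x i + ∑ t ∈ Ico (i + 1) (k + 1), natExt m t < 0 := by
    have h := lindleyNat_hit_iff (natExt w) (natExt m) (j := j) (k := k) hk
    rw [natExt_apply m k, natExt_apply w j] at h
    have h1 : (∀ i : Fin (n + 1), j < i → i ≤ k → resolve w m i ≠ w i) ↔
        ∀ i, (j : ℕ) < i → i ≤ k → lindleyNat (natExt w) (natExt m) i ≠ natExt w i := by
      constructor
      · intro h i hi hik
        have := h ⟨i, by omega⟩ hi hik
        rwa [← natExt_apply w] at this
      · intro h i hi hik
        rw [← natExt_apply w]
        exact h i hi hik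
    rw [h1]
    refine h.trans (and_congr ?_ (and_congr ?_ ?_))
    · rw [hw, Fin.insertNth_apply_same]
    · refine forall₂_congr fun i hi => ?_
      rw [hw, natExt_insertNth_of_lt _ _ _ hi]
    · constructor
      · intro h i hi hik
        have := h (i + 1) (by omega) (by omega)
        rwa [hw, natExt_insertNth_succ _ _ _ hi (by omega)] at this
      · intro h i hi hik
        obtain ⟨i, rfl⟩ : ∃ i', i = i' + 1 := ⟨i - 1, by omega⟩
        rw [hw, natExt_insertNth_succ _ _ _ (by omega) (by omega)]
        exact h i (by omega) (by omega)
  constructor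
  · rintro ⟨k, r, hrk, h1, h2, h3, h4⟩
    obtain rfl : r = j := (insertPerm j).injective (h4.trans (insertPerm_self j).symm)
    exact ⟨k, hrk, (key k hrk).1 ⟨h1, h2, h3⟩⟩
  · rintro ⟨k, hk, h⟩
    obtain ⟨h1, h2, h3⟩ := (key k hk).2 h
    exact ⟨k, j, hk, h1, h2, h3, insertPerm_self j⟩

lemma exists_rank {n : ℕ} {x : Fin n → ℝ} (hx : StrictMono x) (X : ℝ) :
    ∃ j : Fin (n + 1), ∀ i : Fin n, x i < X ↔ i.castSucc < j := by
  classical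
  have hex : ∃ t, ∀ h : t < n, X ≤ x ⟨t, h⟩ := ⟨n, fun h => absurd h (lt_irrefl _)⟩
  have hle : Nat.find hex ≤ n := Nat.find_min' hex fun h => absurd h (lt_irrefl _)
  refine ⟨⟨Nat.find hex, by omega⟩, fun i => ⟨fun hi => ?_, fun hi => ?_⟩⟩
  · by_contra hcon
    have h1 : Nat.find hex ≤ i := not_lt.1 hcon
    have h2 := Nat.find_spec hex (h1.trans_lt i.2)
    exact absurd (h2.trans (hx.monotone (show (⟨_, h1.trans_lt i.2⟩ : Fin n) ≤ i from h1)))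
      (not_le.2 hi)
  · have := Nat.find_min hex (m := i) hi
    push Not at this
    exact this.2

/-- After inserting the free rod at place `j`, the lengths being `M` in order of left ends, its
cluster has its `k`-th right end at the origin. -/
def HitAt (n : ℕ) (x M : ℕ → ℝ) (k j : ℕ) : Prop :=
  j ≤ k ∧ (∀ i < j, x i + ∑ t ∈ Ico i (k + 1), M t < 0) ∧
    (j < n → 0 < x j + ∑ t ∈ Ico j (k + 1), M t) ∧
    ∀ i, j ≤ i → i < k → x i + ∑ t ∈ Ico (i + 1) (k + 1), M t < 0

/-- Each rod `i < k` ends strictly before the origin when followed by the lengths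
`M (i + 1), …, M k`. -/
def WeakBound (x M : ℕ → ℝ) (k : ℕ) : Prop :=
  ∀ i < k, x i + ∑ t ∈ Ico (i + 1) (k + 1), M t < 0

/-- Each rod `i ≤ k` ends strictly before the origin when followed by the lengths
`M i, …, M k`. -/
def StrongBound (n : ℕ) (x M : ℕ → ℝ) (k : ℕ) : Prop :=
  ∀ i ≤ k, i < n ∧ x i + ∑ t ∈ Ico i (k + 1), M t < 0

open Classical in
lemma card_hitAt_add {n : ℕ} {x M : ℕ → ℝ} {k : ℕ} (hk : k ≤ n) (hM : ∀ t ≤ n, 0 < M t)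
    (hgen : ∀ i < n, ∀ a b, x i + ∑ t ∈ Ico a b, M t ≠ 0) :
    #{j : Fin (n + 1) | HitAt n x M k j} + (if StrongBound n x M k then 1 else 0) =
      if WeakBound x M k then 1 else 0 := by
  have step (i : ℕ) (hi : i < k) (h : x i + ∑ t ∈ Ico i (k + 1), M t < 0) :
      x i + ∑ t ∈ Ico (i + 1) (k + 1), M t < 0 := by
    rw [sum_eq_sum_Ico_succ_bot (by omega)] at h
    linarith [hM i (by omega)]
  have hweak {j : ℕ} (h : HitAt n x M k j) : WeakBound x M k := fun i hi => by
    rcases Nat.lt_or_ge i j with h' | h'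
    · exact step i hi (h.2.1 i h')
    · exact h.2.2.2 i h' hi
  by_cases hW : WeakBound x M k
  · by_cases hS : StrongBound n x M k
    · have : ∀ j : Fin (n + 1), ¬ HitAt n x M k j := fun j hj =>
        absurd (hj.2.2.1 (hS j hj.1).1) (hS j hj.1).2.not_gt
      simp [hW, hS, this]
    · have hex : ∃ i, i ≤ k ∧ ¬ (i < n ∧ x i + ∑ t ∈ Ico i (k + 1), M t < 0) := by
        simpa [StrongBound] using hS
      obtain ⟨h1, h2⟩ := Nat.find_spec hex
      have h3 : ∀ i < Nat.find hex, i < n ∧ x i + ∑ t ∈ Ico i (k + 1), M t < 0 := fun i hi => by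
        by_contra h
        exact Nat.find_min hex hi ⟨by omega, h⟩
      have hH : HitAt n x M k (Nat.find hex) :=
        ⟨h1, fun i hi => (h3 i hi).2, fun hn => lt_of_le_of_ne
          (not_lt.1 fun h => h2 ⟨hn, h⟩) (hgen _ hn _ _).symm, fun i _ hi => hW i hi⟩
      have huniq : ({j : Fin (n + 1) | HitAt n x M k j} : Finset (Fin (n + 1))) =
          {⟨Nat.find hex, by omega⟩} := by
        ext j
        simp only [mem_filter, mem_univ, true_and, mem_singleton]
        refine ⟨fun hj => Fin.ext ?_, fun hj => hj ▸ hH⟩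
        rcases lt_trichotomy (j : ℕ) (Nat.find hex) with h | h | h
        · exact absurd (hj.2.2.1 (h3 j h).1) (h3 j h).2.not_gt
        · exact h
        · exact absurd ⟨by omega, hj.2.1 _ h⟩ h2
      simp [hW, hS, huniq]
  · have hS : ¬ StrongBound n x M k := fun h => hW fun i hi => step i hi (h i hi.le).2
    have : ∀ j : Fin (n + 1), ¬ HitAt n x M k j := fun j hj => hW (hweak hj)
    simp [hW, hS, this]

lemma natExt_comp_finRotate {n : ℕ} (f : Fin (n + 1) → ℝ) {t : ℕ} (ht : t < n) :
    natExt (f ∘ finRotate (n + 1)) t = natExt f (t + 1) := by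
  rw [natExt_of_lt _ (by omega : t < n + 1), natExt_of_lt _ (by omega : t + 1 < n + 1),
    Function.comp, finRotate_of_lt ht]

lemma weakBound_succ_iff {n : ℕ} (x : ℕ → ℝ) (f : Fin (n + 1) → ℝ) {k : ℕ} (hk : k < n) :
    WeakBound x (natExt f) (k + 1) ↔ StrongBound n x (natExt (f ∘ finRotate (n + 1))) k := by
  have e (i : ℕ) : ∑ t ∈ Ico (i + 1) (k + 1 + 1), natExt f t =
      ∑ t ∈ Ico i (k + 1), natExt (f ∘ finRotate (n + 1)) t := by
    rw [← sum_Ico_add']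
    refine sum_congr rfl fun t ht => (natExt_comp_finRotate f ?_).symm
    have := (mem_Ico.1 ht).2
    omega
  unfold WeakBound StrongBound
  simp only [e]
  exact ⟨fun h i hi => ⟨by omega, h i (by omega)⟩, fun h i hi => (h i (by omega)).2⟩

open Classical in
/-- Counting arrangements of the lengths, the hits telescope over `k`. -/
lemma sum_card_hitAt {n : ℕ} (x : ℕ → ℝ) (f : Fin (n + 1) → ℝ) (hf : ∀ i, 0 < f i)
    (hgen : ∀ ρ : Equiv.Perm (Fin (n + 1)), ∀ i < n, ∀ a b,
      x i + ∑ t ∈ Ico a b, natExt (f ∘ ρ) t ≠ 0) :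
    ∑ k ∈ range (n + 1), ∑ ρ : Equiv.Perm (Fin (n + 1)),
      #{j : Fin (n + 1) | HitAt n x (natExt (f ∘ ρ)) k j} = (n + 1).factorial := by
  let A (k : ℕ) := ∑ ρ : Equiv.Perm (Fin (n + 1)), if WeakBound x (natExt (f ∘ ρ)) k then 1 else 0
  let B (k : ℕ) :=
    ∑ ρ : Equiv.Perm (Fin (n + 1)), if StrongBound n x (natExt (f ∘ ρ)) k then 1 else 0
  let C (k : ℕ) := ∑ ρ : Equiv.Perm (Fin (n + 1)),
      #{j : Fin (n + 1) | HitAt n x (natExt (f ∘ ρ)) k j}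
  have hC (k : ℕ) (hk : k ≤ n) : C k + B k = A k := by
    simp only [A, B, C]
    rw [← sum_add_distrib]
    refine sum_congr rfl fun ρ _ => card_hitAt_add hk (fun t ht => ?_) (hgen ρ)
    rw [natExt_of_lt _ (by omega : t < n + 1)]
    exact hf _
  have hAB (k : ℕ) (hk : k < n) : A (k + 1) = B k := by
    refine Fintype.sum_equiv (Equiv.mulRight (finRotate (n + 1))) _ _ fun ρ => ?_
    rw [weakBound_succ_iff x _ hk]
    rfl
  have hA : A 0 = (n + 1).factorial := by
    simp [A, WeakBound, Fintype.card_perm]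
  have hB : B n = 0 := by
    refine sum_eq_zero fun ρ _ => if_neg fun h => ?_
    exact absurd (h n le_rfl).1 (lt_irrefl _)
  have main (m : ℕ) (hm : m ≤ n) : ∑ k ∈ range (m + 1), C k + B m = A 0 := by
    induction m with
    | zero => simpa using hC 0 hm
    | succ m ih =>
      rw [sum_range_succ, add_assoc, hC _ hm, hAB m (by omega)]
      exact ih (by omega)
  have := main n le_rfl
  rw [hB, hA] at this
  exact this

lemma sum_natExt_pos {n : ℕ} {f : Fin (n + 1) → ℝ} (hf : ∀ i, 0 < f i) {a b : ℕ} (hab : a < b)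
    (hb : b ≤ n + 1) : 0 < ∑ t ∈ Ico a b, natExt f t :=
  sum_pos (fun t ht => by
    rw [natExt_of_lt _ (by have := (mem_Ico.1 ht).2; omega)]
    exact hf _) (nonempty_Ico.2 hab)

/-- The location of the free rod inserted at place `j` whose cluster has its `k`-th right end at
the origin. -/
noncomputable def hitLocation {n : ℕ} (l : Fin (n + 1) → ℝ) (q : Fin (n + 1) × Fin (n + 1)) : ℝ :=
  -∑ t ∈ Ico (q.1 : ℕ) (q.2 + 1), natExt (l ∘ insertPerm q.1) t

lemma HitAt.lt_hitLocation_iff {n : ℕ} {x : Fin n → ℝ} (hx : StrictMono x) {l : Fin (n + 1) → ℝ}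
    (hl : ∀ i, 0 < l i) {j k : Fin (n + 1)}
    (h : HitAt n (natExt x) (natExt (l ∘ insertPerm j)) k j) (i : Fin n) :
    (x i < hitLocation l (j, k) ↔ i.castSucc < j) ∧ hitLocation l (j, k) ≠ x i := by
  have hjk : (j : ℕ) ≤ k := h.1
  simp only [hitLocation]
  rcases Nat.lt_or_ge i j with hi | hi
  · have h1 := h.2.1 i hi
    rw [natExt_apply, ← sum_Ico_consecutive _ hi.le (by omega : (j : ℕ) ≤ k + 1)] at h1
    have h2 := sum_natExt_pos (f := l ∘ insertPerm j) (fun _ => hl _) hi (by omega)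
    have h3 : x i < -∑ t ∈ Ico (j : ℕ) (k + 1), natExt (l ∘ insertPerm j) t := by linarith
    exact ⟨iff_of_true h3 hi, h3.ne'⟩
  · have hjn : (j : ℕ) < n := by omega
    have h1 := h.2.2.1 hjn
    rw [natExt_of_lt _ hjn] at h1
    have h2 : x ⟨j, hjn⟩ ≤ x i := hx.monotone hi
    have h3 : -∑ t ∈ Ico (j : ℕ) (k + 1), natExt (l ∘ insertPerm j) t < x i := by linarith
    exact ⟨iff_of_false h3.not_gt (not_lt.2 hi), h3.ne⟩

lemma injOn_hitLocation {n : ℕ} {x : Fin n → ℝ} (hx : StrictMono x) {l : Fin (n + 1) → ℝ}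
    (hl : ∀ i, 0 < l i) :
    Set.InjOn (hitLocation l)
      {q | HitAt n (natExt x) (natExt (l ∘ insertPerm q.1)) q.2 q.1} := by
  rintro ⟨j, k⟩ h ⟨j', k'⟩ h' e
  simp only [Set.mem_ofPred_eq] at h h'
  have h1 : ∀ i : Fin n, i.castSucc < j ↔ i.castSucc < j' := fun i => by
    rw [← (h.lt_hitLocation_iff hx hl i).1, ← (h'.lt_hitLocation_iff hx hl i).1, e]
  obtain rfl : j = j' := by
    rcases lt_trichotomy j j' with hj | hj | hj
    · exact absurd ((h1 ⟨j, by have := j'.2; simp only [Fin.lt_def] at hj; omega⟩).2 hj) (lt_irrefl _)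
    · exact hj
    · exact absurd ((h1 ⟨j', by have := j.2; simp only [Fin.lt_def] at hj; omega⟩).1 hj) (lt_irrefl _)
  have key (a b : Fin (n + 1)) (ha : (j : ℕ) ≤ a) (hab : a < b) :
      hitLocation l (j, a) ≠ hitLocation l (j, b) := by
    simp only [hitLocation]
    have hab' : (a : ℕ) < b := hab
    rw [← sum_Ico_consecutive _ (by omega : (j : ℕ) ≤ a + 1) (by omega : (a : ℕ) + 1 ≤ b + 1)]
    have := sum_natExt_pos (f := l ∘ insertPerm j) (fun _ => hl _)
      (by omega : (a : ℕ) + 1 < b + 1) (by omega)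
    intro h
    linarith
  rcases lt_trichotomy k k' with hk | rfl | hk
  · exact absurd e (key k k' h.1 hk)
  · rfl
  · exact absurd e.symm (key k' k h'.1 hk)

lemma setOf_isXHit_eq_image {n : ℕ} {x : Fin n → ℝ} (hx : StrictMono x) {l : Fin (n + 1) → ℝ}
    (hl : ∀ i, 0 < l i)
    (hgen : ∀ j : Fin (n + 1), ∀ i < n, ∀ a b,
      natExt x i + ∑ t ∈ Ico a b, natExt (l ∘ insertPerm j) t ≠ 0) :
    {X : ℝ | (∀ i, X ≠ x i) ∧ IsXHit (Fin.snoc x X) l (Fin.last n)} =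
      hitLocation l '' {q | HitAt n (natExt x) (natExt (l ∘ insertPerm q.1)) q.2 q.1} := by
  ext X
  constructor
  · rintro ⟨hX, h⟩
    obtain ⟨j, hj⟩ := exists_rank hx X
    obtain ⟨k, hjk, h1, h2, h3⟩ := (isXHit_snoc_iff hx hX hj l).1 h
    refine ⟨(j, k), ⟨hjk, fun i hi => lt_of_le_of_ne (h2 i hi) (hgen j i (by omega) _ _),
      fun hn => ?_, h3⟩, ?_⟩
    · have := lt_of_le_of_ne (not_lt.1 (mt (hj ⟨j, hn⟩).1 (lt_irrefl _))) (hX _)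
      rw [natExt_of_lt _ hn]
      linarith
    · simp only [hitLocation]
      linarith
  · rintro ⟨⟨j, k⟩, h, rfl⟩
    have hX := fun i => (HitAt.lt_hitLocation_iff hx hl h i).2
    refine ⟨hX, (isXHit_snoc_iff hx hX
      (fun i => (HitAt.lt_hitLocation_iff hx hl h i).1) l).2 ⟨k, h.1, ?_,
        fun i hi => (h.2.1 i hi).le, h.2.2.2⟩⟩
    simp [hitLocation]

open Classical in
lemma ncard_isXHit {n : ℕ} {x : Fin n → ℝ} (hx : StrictMono x) {l : Fin (n + 1) → ℝ}
    (hl : ∀ i, 0 < l i)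
    (hgen : ∀ j : Fin (n + 1), ∀ i < n, ∀ a b,
      natExt x i + ∑ t ∈ Ico a b, natExt (l ∘ insertPerm j) t ≠ 0) :
    Set.ncard {X : ℝ | (∀ i, X ≠ x i) ∧ IsXHit (Fin.snoc x X) l (Fin.last n)} =
      ∑ j : Fin (n + 1), ∑ k : Fin (n + 1),
        if HitAt n (natExt x) (natExt (l ∘ insertPerm j)) k j then 1 else 0 := by
  rw [setOf_isXHit_eq_image hx hl hgen, (injOn_hitLocation hx hl).ncard_image,
    Set.ncard_eq_toFinset_card', Set.toFinset_ofPred, card_filter, Fintype.sum_prod_type]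

lemma exists_sum_natExt_eq {n : ℕ} (f : Fin n → ℝ) (ρ : Equiv.Perm (Fin n)) (a b : ℕ) :
    ∃ s : Finset (Fin n), ∑ t ∈ Ico a b, natExt (f ∘ ρ) t = ∑ i ∈ s, f i := by
  refine ⟨(univ.filter fun i : Fin n => a ≤ i ∧ (i : ℕ) < b).map ρ.toEmbedding, ?_⟩
  rw [sum_map]
  symm
  refine sum_of_injOn (fun i : Fin n => (i : ℕ)) Fin.val_injective.injOn ?_ ?_ ?_
  · intro i hi
    simpa using hi
  · intro t ht ht'
    by_cases h : t < n
    · refine absurd ⟨⟨t, h⟩, ?_, rfl⟩ ht'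
      simpa using ht
    · simp [natExt, h]
  · intro i _
    simp [natExt_apply]

lemma ae_add_sum_ne_zero (n : ℕ) :
    ∀ᵐ xl : (Fin n → ℝ) × (Fin (n + 1) → ℝ) ∂volume,
      ∀ (i : Fin n) (s : Finset (Fin (n + 1))), xl.1 i + ∑ t ∈ s, xl.2 t ≠ 0 := by
  rw [ae_all_iff]
  intro i
  rw [ae_all_iff]
  intro s
  let L : (Fin n → ℝ) × (Fin (n + 1) → ℝ) →ₗ[ℝ] ℝ :=
    LinearMap.proj i ∘ₗ LinearMap.fst ℝ _ _ +
      (∑ t ∈ s, LinearMap.proj t) ∘ₗ LinearMap.snd ℝ _ _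
  have hL (xl) : L xl = xl.1 i + ∑ t ∈ s, xl.2 t := by simp [L]
  have hne : LinearMap.ker L ≠ ⊤ := by
    intro h
    have h1 : ((Pi.single i 1, 0) : (Fin n → ℝ) × (Fin (n + 1) → ℝ)) ∈ LinearMap.ker L :=
      h ▸ Submodule.mem_top
    rw [LinearMap.mem_ker, hL] at h1
    simp at h1
  rw [ae_iff]
  have : (volume : Measure ((Fin n → ℝ) × (Fin (n + 1) → ℝ))).IsAddHaarMeasure := by
    rw [Measure.volume_eq_prod]
    exact Measure.prod.instIsAddHaarMeasure _ _
  convert Measure.addHaar_submodule volume (LinearMap.ker L) hne using 2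
  ext xl
  simp [hL]

/-- **Theorem (rod placements).** For `n + 1 ≥ 1` rods, for Lebesgue-almost every choice of
left ends `x₁ < … < xₙ` and positive lengths `λ₁ < … < λ_{n+1}`, the total number of
locations `X` producing an `X`-hit of the origin, summed over all permutations `π` of the
lengths (the rod `λ_{π i}` being placed at `x i` for `i < n+1` and the free rod `λ_{π (last)}`
being placed at `X`), equals `(n+1)!`. -/
theorem total_hit_count_eq_factorial (n : ℕ) :
    ∀ᵐ xl : (Fin n → ℝ) × (Fin (n + 1) → ℝ) ∂volume,
      (StrictMono xl.1 ∧ StrictMono xl.2 ∧ ∀ i, 0 < xl.2 i) →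
        ∑ π : Equiv.Perm (Fin (n + 1)),
            Set.ncard {X : ℝ | (∀ i, X ≠ xl.1 i) ∧
              IsXHit (Fin.snoc xl.1 X) (xl.2 ∘ π) (Fin.last n)} =
          Nat.factorial (n + 1) := by
  classical
  filter_upwards [ae_add_sum_ne_zero n] with ⟨x, f⟩ hgen ⟨hx, _, hf⟩
  have hgen' (ρ : Equiv.Perm (Fin (n + 1))) (i : ℕ) (hi : i < n) (a b : ℕ) :
      natExt x i + ∑ t ∈ Ico a b, natExt (f ∘ ρ) t ≠ 0 := by
    obtain ⟨s, hs⟩ := exists_sum_natExt_eq f ρ a b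
    rw [hs, natExt_of_lt x hi]
    exact hgen _ _
  have hcount (π : Equiv.Perm (Fin (n + 1))) :
      Set.ncard {X : ℝ | (∀ i, X ≠ x i) ∧ IsXHit (Fin.snoc x X) (f ∘ π) (Fin.last n)} =
        ∑ j : Fin (n + 1), ∑ k : Fin (n + 1),
          if HitAt n (natExt x) (natExt (f ∘ (π * insertPerm j))) k j then 1 else 0 :=
    ncard_isXHit hx (fun i => hf (π i)) fun j => hgen' (π * insertPerm j)
  have hshift (j : Fin (n + 1)) :
      (∑ π : Equiv.Perm (Fin (n + 1)), ∑ k : Fin (n + 1),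
        if HitAt n (natExt x) (natExt (f ∘ (π * insertPerm j))) k j then 1 else 0) =
      ∑ ρ : Equiv.Perm (Fin (n + 1)), ∑ k : Fin (n + 1),
        if HitAt n (natExt x) (natExt (f ∘ ρ)) k j then 1 else 0 :=
    Equiv.sum_comp (Equiv.mulRight (insertPerm j)) fun ρ : Equiv.Perm (Fin (n + 1)) =>
      ∑ k : Fin (n + 1), if HitAt n (natExt x) (natExt (f ∘ ρ)) k j then 1 else 0
  rw [← sum_card_hitAt (natExt x) f hf hgen', sum_range, sum_congr rfl fun π _ => hcount π,
    sum_comm, sum_congr rfl fun j _ => hshift j, sum_comm]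
  simp only [card_filter]
  rw [sum_comm (s := (univ : Finset (Fin (n + 1))))]
  exact sum_congr rfl fun ρ _ => sum_comm
end

section
/- Let f : ℝ → ℝ satisfy 0 ≤ f(x) ≤ C for all x and be Lipschitz with some constant 𝓛, and let (q_x)_{x ≥ 0} be a measurable family of probability densities on [0,∞) satisfying: (Tightness) for every ε > 0 there is K(ε) with ∫_0^{K(ε)} q_x(t) dt ≥ 1−ε for all x ≥ 0; (Positivity) for every T > 0 there is X(T) < ∞ such that for every δ > 0, F_T(δ) := inf over x ≥ X(T) and over measurable D ⊆ [0,T] with Lebesgue measure at least δ of ∫_D q_x(t) dt, is strictly positive; (Moment bound) for some β > 1 and B < ∞, ∫_0^∞ t^β q_x(t) dt ≤ B for all x ≥ 0; (Near-zero bound) q_x(t) ≤ C̃ for all x ≥ 0 and all t ∈ [0,1]. Suppose f(x) = ∫_0^∞ f(x−t) q_x(t) dt for every x ≥ 0. Then there exists c ≥ 0 such that f(x) → c as x → ∞. -/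
open MeasureTheory

/-- Lower bound for the increments of `u ↦ u ^ (1 - β)`. -/
lemma mul_rpow_neg_le_rpow_sub_rpow {s u β : ℝ} (hs : 0 < s) (hsu : s < u) (hβ : 1 < β) :
    s * (β - 1) * u ^ (-β) ≤ (u - s) ^ (1 - β) - u ^ (1 - β) := by
  have hu : 0 < u := hs.trans hsu
  have hr : 0 < 1 - s / u := by
    have := (div_lt_one hu).2 hsu
    linarith
  have hfac : u - s = u * (1 - s / u) := by field_simp
  have hbern : 1 + (β - 1) * (s / u) ≤ (1 - s / u) ^ (1 - β) := by
    rw [Real.rpow_def_of_pos hr]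
    have hlog := Real.log_le_sub_one_of_pos hr
    have hexp := Real.add_one_le_exp (Real.log (1 - s / u) * (1 - β))
    nlinarith
  have hsplit : u ^ (1 - β) = u * u ^ (-β) := by
    rw [sub_eq_add_neg, Real.rpow_add hu, Real.rpow_one]
  have hmul := mul_le_mul_of_nonneg_left hbern (Real.rpow_nonneg hu.le (1 - β))
  rw [hfac, Real.mul_rpow hu.le hr.le]
  have hexpand : u ^ (1 - β) * (1 + (β - 1) * (s / u))
      = u ^ (1 - β) + s * (β - 1) * u ^ (-β) := by
    rw [hsplit]
    field_simp
  linarith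

/-- A pointwise bound by a constant, an indicator and a multiple of `t ^ β` integrates against a
probability density with bounded moment of order `β`. -/
lemma integral_mul_density_le {ρ g : ℝ → ℝ} {β B c₀ c₁ c₂ : ℝ} {D : Set ℝ}
    (hρ : ∀ t, 0 ≤ ρ t) (hqint : IntegrableOn ρ (Set.Ioi 0))
    (hprob : ∫ t in Set.Ioi (0 : ℝ), ρ t = 1)
    (hmomint : IntegrableOn (fun t => t ^ β * ρ t) (Set.Ioi 0))
    (hmom : ∫ t in Set.Ioi (0 : ℝ), t ^ β * ρ t ≤ B)
    (hg : IntegrableOn (fun t => g t * ρ t) (Set.Ioi 0))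
    (hD : MeasurableSet D) (hD0 : D ⊆ Set.Ioi 0) (hc₂ : 0 ≤ c₂)
    (hle : ∀ t, 0 < t → g t ≤ c₀ + c₁ * D.indicator 1 t + c₂ * t ^ β) :
    ∫ t in Set.Ioi (0 : ℝ), g t * ρ t ≤ c₀ + c₁ * (∫ t in D, ρ t) + c₂ * B := by
  have hDint : IntegrableOn (D.indicator ρ) (Set.Ioi 0) := hqint.indicator hD
  have hval : ∫ t in Set.Ioi (0 : ℝ), D.indicator ρ t = ∫ t in D, ρ t := by
    rw [setIntegral_indicator hD, Set.inter_eq_self_of_subset_right hD0]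
  have h₁ : IntegrableOn (fun t => c₀ * ρ t + c₁ * D.indicator ρ t) (Set.Ioi 0) :=
    (hqint.const_mul c₀).add (hDint.const_mul c₁)
  have h₂ : IntegrableOn (fun t => c₂ * (t ^ β * ρ t)) (Set.Ioi 0) := hmomint.const_mul c₂
  calc ∫ t in Set.Ioi (0 : ℝ), g t * ρ t
      ≤ ∫ t in Set.Ioi (0 : ℝ),
          ((c₀ * ρ t + c₁ * D.indicator ρ t) + c₂ * (t ^ β * ρ t)) := by
        refine setIntegral_mono_on hg (h₁.add h₂) measurableSet_Ioi fun t ht => ?_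
        have hmul := mul_le_mul_of_nonneg_right (hle t ht) (hρ t)
        have hind : D.indicator ρ t = D.indicator 1 t * ρ t := by
          by_cases h : t ∈ D <;> simp [h]
        rw [hind]
        linarith
    _ = c₀ + c₁ * (∫ t in D, ρ t) + c₂ * ∫ t in Set.Ioi (0 : ℝ), t ^ β * ρ t := by
        rw [integral_add h₁ h₂, integral_add (hqint.const_mul c₀) (hDint.const_mul c₁),
          integral_const_mul, integral_const_mul, integral_const_mul, hprob, hval, mul_one]
    _ ≤ _ := by gcongr

lemma integrableOn_rpow_mul_of_lintegral_le {ρ : ℝ → ℝ} {β B : ℝ} (hmeas : Measurable ρ)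
    (hρ : ∀ t, 0 ≤ ρ t)
    (hmom : (∫⁻ t in Set.Ioi (0:ℝ), ENNReal.ofReal (t ^ β * ρ t)) ≤ ENNReal.ofReal B) :
    IntegrableOn (fun t => t ^ β * ρ t) (Set.Ioi 0) ∧
      ∫ t in Set.Ioi (0 : ℝ), t ^ β * ρ t ≤ max B 0 := by
  have hm : Measurable fun t : ℝ => t ^ β * ρ t := by fun_prop
  have hnn : 0 ≤ᵐ[volume.restrict (Set.Ioi 0)] fun t : ℝ => t ^ β * ρ t := by
    filter_upwards [ae_restrict_mem measurableSet_Ioi] with t ht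
    exact mul_nonneg (Real.rpow_nonneg (le_of_lt ht) β) (hρ t)
  constructor
  · refine ⟨hm.aestronglyMeasurable, ?_⟩
    rw [hasFiniteIntegral_iff_ofReal hnn]
    exact hmom.trans_lt ENNReal.ofReal_lt_top
  · rw [integral_eq_lintegral_of_nonneg_ae hnn hm.aestronglyMeasurable]
    exact (ENNReal.toReal_mono ENNReal.ofReal_ne_top hmom).trans_eq ENNReal.toReal_ofReal'

/-- If `f ≥ a` on a window of length `2 * T` ending at `x₀`, then `f` stays above `a` up to an
error of order `T ^ (1 - β)` to the right of `x₀`. -/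
lemma le_of_le_on_window {β B s T a x₀ : ℝ} (hβ : 1 < β) (hB : 0 ≤ B) (hs : 0 < s) (hsT : s < T)
    (ha : 0 ≤ a) (hx₀ : 0 ≤ x₀) {f : ℝ → ℝ} (hf : ∀ x, 0 ≤ f x) {q : ℝ → ℝ → ℝ}
    (hqnn : ∀ x t : ℝ, 0 ≤ q x t)
    (hqint : ∀ x, 0 ≤ x → IntegrableOn (q x) (Set.Ioi 0))
    (hqprob : ∀ x, 0 ≤ x → (∫ t in Set.Ioi (0:ℝ), q x t) = 1)
    (hmomint : ∀ x, 0 ≤ x → IntegrableOn (fun t => t ^ β * q x t) (Set.Ioi 0))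
    (hmom : ∀ x, 0 ≤ x → ∫ t in Set.Ioi (0 : ℝ), t ^ β * q x t ≤ B)
    (hnear : ∀ x, 0 ≤ x → ∫ t in Set.Ioc 0 s, q x t ≤ 1 / 2)
    (hfq : ∀ x, 0 ≤ x → IntegrableOn (fun t => f (x - t) * q x t) (Set.Ioi 0))
    (heq : ∀ x, 0 ≤ x → f x = ∫ t in Set.Ioi (0:ℝ), f (x - t) * q x t)
    (hwin : ∀ y ∈ Set.Icc (x₀ - 2 * T) x₀, a ≤ f y) :
    ∀ y, x₀ ≤ y → a * (1 - 2 * B / (s * (β - 1)) * T ^ (1 - β)) ≤ f y := by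
  have hT : 0 < T := hs.trans hsT
  have hβ' : 0 < β - 1 := by linarith
  set A := 2 * B / (s * (β - 1)) with hA
  have hA0 : 0 ≤ A := by positivity
  have hAs : A * (s * (β - 1)) = 2 * B := by rw [hA]; field_simp
  set k : ℝ → ℝ := fun u => a * (1 - A * T ^ (1 - β) + A * u ^ (1 - β)) with hk
  have kanti : ∀ u v, 0 < u → u ≤ v → k v ≤ k u := by
    intro u v hu huv
    have := Real.rpow_le_rpow_of_nonpos hu huv (by linarith : 1 - β ≤ 0)
    simp only [hk]
    gcongr
  have kT : k T = a := by simp [hk]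
  have kle : ∀ u, T ≤ u → k u ≤ a := fun u hu => (kanti T u hT hu).trans_eq kT
  have step : ∀ z, x₀ ≤ z → (∀ y, x₀ - T ≤ y → y ≤ z → k (y - x₀ + 2 * T) ≤ f y) → ∀ γ, 0 ≤ γ →
      (∀ y, x₀ - T ≤ y → y ≤ z + s → k (y - x₀ + 2 * T) - γ ≤ f y) →
      ∀ y, x₀ - T ≤ y → y ≤ z + s → k (y - x₀ + 2 * T) - γ / 2 ≤ f y := by
    intro z hz hprev γ hγ hcur y hy1 hy2
    rcases le_or_gt y x₀ with hyx | hyx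
    · have := hprev y hy1 (hyx.trans hz)
      linarith
    have hy0 : 0 ≤ y := by linarith
    set u := y - x₀ + 2 * T with hu
    have hu0 : 0 < u := by linarith
    have hgain : 2 * (a * (u ^ (-β) * B)) ≤ k (u - s) - k u := by
      have h := mul_rpow_neg_le_rpow_sub_rpow hs (by linarith : s < u) hβ
      have h' := mul_le_mul_of_nonneg_left h (mul_nonneg ha hA0)
      have e1 : a * A * (s * (β - 1) * u ^ (-β)) = a * (A * (s * (β - 1))) * u ^ (-β) := by ring
      rw [e1, hAs] at h'
      simp only [hk]
      linarith
    have hΔ : k u ≤ k (u - s) := kanti _ _ (by linarith) (by linarith)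
    have hkey := integral_mul_density_le (g := fun t => - f (y - t)) (c₀ := - k (u - s))
      (c₁ := k (u - s) - k u + γ) (c₂ := a * u ^ (-β)) (D := Set.Ioc 0 s)
      (hqnn y) (hqint y hy0) (hqprob y hy0) (hmomint y hy0) (hmom y hy0)
      (by simp only [neg_mul]; exact (hfq y hy0).neg) measurableSet_Ioc
      (fun t ht => ht.1) (by positivity) (by
        intro t ht
        have htail : 0 ≤ a * u ^ (-β) * t ^ β := by positivity
        rcases le_or_gt t s with hts | hts
        · have hmem : t ∈ Set.Ioc 0 s := ⟨ht, hts⟩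
          simp only [Set.indicator_of_mem hmem, Pi.one_apply]
          have h1 := hcur (y - t) (by linarith) (by linarith)
          have h2 := kanti (y - t - x₀ + 2 * T) u (by linarith) (by linarith)
          linarith
        · have hmem : t ∉ Set.Ioc 0 s := fun h => hts.not_ge h.2
          simp only [Set.indicator_of_notMem hmem, mul_zero, add_zero]
          rcases le_or_gt (x₀ - T) (y - t) with h | h
          · have h1 := hprev (y - t) h (by linarith)
            have h2 := kanti (y - t - x₀ + 2 * T) (u - s) (by linarith) (by linarith)
            linarith
          · have hka : k (u - s) ≤ a := kle _ (by linarith)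
            rcases le_or_gt (x₀ - 2 * T) (y - t) with h' | h'
            · have h1 := hwin (y - t) ⟨h', by linarith⟩
              linarith
            · have h1 : 1 ≤ u ^ (-β) * t ^ β := by
                rw [Real.rpow_neg hu0.le, inv_mul_eq_div, one_le_div (by positivity)]
                exact Real.rpow_le_rpow hu0.le (by linarith) (by linarith)
              have h2 := mul_le_mul_of_nonneg_left h1 ha
              have h3 := hf (y - t)
              linarith)
    simp only [neg_mul, integral_neg] at hkey
    rw [← heq y hy0] at hkey
    have hhalf := mul_le_mul_of_nonneg_left (hnear y hy0)
      (by linarith : 0 ≤ k (u - s) - k u + γ)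
    linarith
  have main : ∀ n : ℕ, ∀ y, x₀ - T ≤ y → y ≤ x₀ + n * s → k (y - x₀ + 2 * T) ≤ f y := by
    intro n
    induction n with
    | zero =>
      intro y hy1 hy2
      have hy2' : y ≤ x₀ := by simpa using hy2
      exact (kle _ (by linarith)).trans (hwin y ⟨by linarith, hy2'⟩)
    | succ n ih =>
      have hz : x₀ ≤ x₀ + n * s := by
        have : 0 ≤ (n : ℝ) * s := by positivity
        linarith
      have hdeficit : ∀ m : ℕ, ∀ y, x₀ - T ≤ y → y ≤ x₀ + n * s + s →
          k (y - x₀ + 2 * T) - a * (1 / 2) ^ m ≤ f y := by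
        intro m
        induction m with
        | zero =>
          intro y hy1 _
          have h1 := kle (y - x₀ + 2 * T) (by linarith)
          have h2 := hf y
          simp only [pow_zero, mul_one]
          linarith
        | succ m ihm =>
          intro y hy1 hy2
          have := step _ hz ih (a * (1 / 2) ^ m) (by positivity) ihm y hy1 hy2
          rw [pow_succ]
          linarith
      intro y hy1 hy2
      have hlim : Filter.Tendsto (fun m : ℕ => k (y - x₀ + 2 * T) - a * (1 / 2 : ℝ) ^ m)
          Filter.atTop (nhds (k (y - x₀ + 2 * T) - a * 0)) :=
        ((tendsto_pow_atTop_nhds_zero_of_lt_one (by norm_num) (by norm_num)).const_mul a).const_sub _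
      rw [mul_zero, sub_zero] at hlim
      refine le_of_tendsto' hlim fun m => hdeficit m y hy1 ?_
      push_cast at hy2
      linarith
  intro y hy
  obtain ⟨n, hn⟩ := exists_nat_ge ((y - x₀) / s)
  rw [div_le_iff₀ hs] at hn
  have h := main n y (by linarith) (by linarith)
  have h0 : 0 ≤ a * (A * (y - x₀ + 2 * T) ^ (1 - β)) :=
    mul_nonneg ha (mul_nonneg hA0 (Real.rpow_nonneg (by linarith) _))
  simp only [hk] at h
  linarith

/-- Arbitrarily far out there are windows of any length on which `f` is almost as large as an
asymptotic upper bound `M` that is approached arbitrarily far out. -/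
lemma exists_window_ge {C Lip β B M T ε : ℝ} (hβ : 1 < β) (hM : 0 ≤ M) (hT : 0 < T) (hε : 0 < ε)
    {f : ℝ → ℝ} (hfC : ∀ x, f x ≤ C)
    (hC : 0 ≤ C) (hlip : ∀ x y : ℝ, |f x - f y| ≤ Lip * |x - y|)
    {q : ℝ → ℝ → ℝ} (hqnn : ∀ x t : ℝ, 0 ≤ q x t)
    (hqint : ∀ x, 0 ≤ x → IntegrableOn (q x) (Set.Ioi 0))
    (hqprob : ∀ x, 0 ≤ x → (∫ t in Set.Ioi (0:ℝ), q x t) = 1)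
    (hpos : ∀ T > (0:ℝ), ∃ X : ℝ, ∀ δ > (0:ℝ), ∃ c > (0:ℝ), ∀ x, X ≤ x →
      ∀ D : Set ℝ, MeasurableSet D → D ⊆ Set.Icc 0 T → δ ≤ (volume D).toReal →
        c ≤ ∫ t in D, q x t)
    (hmomint : ∀ x, 0 ≤ x → IntegrableOn (fun t => t ^ β * q x t) (Set.Ioi 0))
    (hmom : ∀ x, 0 ≤ x → ∫ t in Set.Ioi (0 : ℝ), t ^ β * q x t ≤ B)
    (hfq : ∀ x, 0 ≤ x → IntegrableOn (fun t => f (x - t) * q x t) (Set.Ioi 0))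
    (heq : ∀ x, 0 ≤ x → f x = ∫ t in Set.Ioi (0:ℝ), f (x - t) * q x t)
    (hupper : ∀ η > 0, ∀ᶠ x in Filter.atTop, f x < M + η)
    (hfreq : ∀ η > 0, ∃ᶠ x in Filter.atTop, M - η < f x) :
    ∃ x, 0 ≤ x ∧ ∀ y ∈ Set.Icc (x - T) x, M - ε ≤ f y := by
  obtain ⟨X, hX⟩ := hpos T hT
  set L := |Lip| + 1 with hL
  have hL0 : 0 < L := by positivity
  set δ := min (T / 2) (ε / (2 * L)) with hδ
  have hδ0 : 0 < δ := by positivity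
  have hδT : δ ≤ T / 2 := min_le_left _ _
  have hδL : L * δ ≤ ε / 2 := by
    have h := mul_le_mul_of_nonneg_left (min_le_right (T / 2) (ε / (2 * L))) hL0.le
    have e : L * (ε / (2 * L)) = ε / 2 := by field_simp
    linarith
  obtain ⟨c, hc0, hc⟩ := hX δ hδ0
  set η := c * ε / 8 with hη
  have hη0 : 0 < η := by positivity
  obtain ⟨X₀, hX₀⟩ := Filter.eventually_atTop.1 (hupper η hη0)
  have htail : Filter.Tendsto (fun x : ℝ => C * (x - X₀) ^ (-β) * B) Filter.atTop (nhds 0) := by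
    have h := ((tendsto_rpow_neg_atTop (by linarith : 0 < β)).comp
      (Filter.tendsto_atTop_add_const_right Filter.atTop (-X₀) Filter.tendsto_id))
    simpa [sub_eq_add_neg] using (h.const_mul C).mul_const B
  obtain ⟨x, hxM, hxtail, hxX, hx0, hxX₀⟩ := ((hfreq η hη0).and_eventually
    ((htail.eventually_lt_const hη0).and ((Filter.eventually_ge_atTop X).and
      ((Filter.eventually_ge_atTop 0).and (Filter.eventually_ge_atTop (X₀ + T)))))).exists
  refine ⟨x, hx0, ?_⟩
  by_contra! hcon
  obtain ⟨y, ⟨hy1, hy2⟩, hy⟩ := hcon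
  obtain ⟨p, hp0, hpT, hp⟩ : ∃ p, 0 ≤ p ∧ p + δ ≤ T ∧
      ∀ t ∈ Set.Ioc p (p + δ), |x - t - y| ≤ δ := by
    rcases le_or_gt (x - y) (T / 2) with h | h
    · refine ⟨x - y, by linarith, by linarith, fun t ht => abs_le.2 ⟨?_, ?_⟩⟩ <;>
        linarith [ht.1, ht.2]
    · refine ⟨x - y - δ, by linarith, by linarith, fun t ht => abs_le.2 ⟨?_, ?_⟩⟩ <;>
        linarith [ht.1, ht.2]
  have hmass := hc x hxX (Set.Ioc p (p + δ)) measurableSet_Ioc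
    (fun t ht => ⟨hp0.trans ht.1.le, ht.2.trans hpT⟩) (by simp [hδ0.le])
  have hkey := integral_mul_density_le (g := fun t => f (x - t)) (c₀ := M + η)
    (c₁ := -(ε / 2)) (c₂ := C * (x - X₀) ^ (-β)) (D := Set.Ioc p (p + δ))
    (hqnn x) (hqint x hx0) (hqprob x hx0) (hmomint x hx0) (hmom x hx0)
    (hfq x hx0) measurableSet_Ioc (fun t ht => hp0.trans_lt ht.1)
    (mul_nonneg hC (Real.rpow_nonneg (by linarith) _)) (by
      intro t ht
      have hnn : 0 ≤ C * (x - X₀) ^ (-β) * t ^ β :=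
        mul_nonneg (mul_nonneg hC (Real.rpow_nonneg (by linarith) _)) (by positivity)
      by_cases hmem : t ∈ Set.Ioc p (p + δ)
      · simp only [Set.indicator_of_mem hmem, Pi.one_apply]
        have h1 := (le_abs_self _).trans (hlip (x - t) y)
        have h2 : Lip * |x - t - y| ≤ L * δ := by
          refine mul_le_mul ?_ (hp t hmem) (abs_nonneg _) hL0.le
          linarith [le_abs_self Lip]
        linarith
      · simp only [Set.indicator_of_notMem hmem, mul_zero, add_zero]
        rcases le_or_gt X₀ (x - t) with h | h
        · have := hX₀ (x - t) h
          linarith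
        · have hpos' : 0 < x - X₀ := by linarith
          have h1 : 1 ≤ (x - X₀) ^ (-β) * t ^ β := by
            rw [Real.rpow_neg hpos'.le, inv_mul_eq_div, one_le_div (by positivity)]
            exact Real.rpow_le_rpow hpos'.le (by linarith) (by linarith)
          have h2 := mul_le_mul_of_nonneg_left h1 hC
          have h3 := hfC (x - t)
          linarith)
  rw [← heq x hx0] at hkey
  have h4 := mul_le_mul_of_nonneg_left hmass (by positivity : 0 ≤ ε / 2)
  have h5 : 0 < c * ε := by positivity
  linarith

/-- **Theorem (infinite range self-averaging implies relaxation).** Let `f : ℝ → ℝ` with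
`0 ≤ f ≤ C`, Lipschitz with constant `Lip`, and let `(q_x)_{x ≥ 0}` be a measurable family
of probability densities on `[0,∞)` which is tight (uniformly in `x`), satisfies the
positivity property (the infimum `F_T(δ)` of the mass given to subsets of `[0,T]` of
measure `≥ δ`, over `x ≥ X(T)`, is positive), has uniformly bounded moments of some order
`β > 1`, and is uniformly bounded near zero. If `f x = ∫_0^∞ f (x−t) q_x(t) dt` for every
`x ≥ 0`, then `f x → c` as `x → ∞` for some `c ≥ 0`. -/
theorem infinite_range_selfAveraging_relaxation
    (C Lip β B Ctil : ℝ) (hβ : 1 < β)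
    (f : ℝ → ℝ) (hf : ∀ x, 0 ≤ f x ∧ f x ≤ C)
    (hlip : ∀ x y : ℝ, |f x - f y| ≤ Lip * |x - y|)
    (q : ℝ → ℝ → ℝ)
    (hqmeas : Measurable fun pr : ℝ × ℝ => q pr.1 pr.2)
    (hqnn : ∀ x t : ℝ, 0 ≤ q x t)
    (hqzero : ∀ x, 0 ≤ x → ∀ t < (0:ℝ), q x t = 0)
    (hqprob : ∀ x, 0 ≤ x → (∫ t in Set.Ioi (0:ℝ), q x t) = 1)
    (htight : ∀ ε > (0:ℝ), ∃ K : ℝ, ∀ x, 0 ≤ x → 1 - ε ≤ ∫ t in (0:ℝ)..K, q x t)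
    (hpos : ∀ T > (0:ℝ), ∃ X : ℝ, ∀ δ > (0:ℝ), ∃ c > (0:ℝ), ∀ x, X ≤ x →
      ∀ D : Set ℝ, MeasurableSet D → D ⊆ Set.Icc 0 T → δ ≤ (volume D).toReal →
        c ≤ ∫ t in D, q x t)
    (hmom : ∀ x, 0 ≤ x →
      (∫⁻ t in Set.Ioi (0:ℝ), ENNReal.ofReal (t ^ β * q x t)) ≤ ENNReal.ofReal B)
    (hnear : ∀ x, 0 ≤ x → ∀ t ∈ Set.Icc (0:ℝ) 1, q x t ≤ Ctil)
    (heq : ∀ x, 0 ≤ x → f x = ∫ t in Set.Ioi (0:ℝ), f (x - t) * q x t) :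
    ∃ c : ℝ, 0 ≤ c ∧ Filter.Tendsto f Filter.atTop (nhds c) := by
  have hC : 0 ≤ C := (hf 0).1.trans (hf 0).2
  have hqm : ∀ x, Measurable (q x) := fun x => hqmeas.comp measurable_prodMk_left
  have hqint : ∀ x, 0 ≤ x → IntegrableOn (q x) (Set.Ioi 0) := by
    intro x hx
    by_contra h
    have h1 := hqprob x hx
    rw [integral_undef h] at h1
    exact zero_ne_one h1
  have hmomint := fun x hx =>
    (integrableOn_rpow_mul_of_lintegral_le (hqm x) (hqnn x) (hmom x hx)).1
  have hmom' := fun x hx =>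
    (integrableOn_rpow_mul_of_lintegral_le (hqm x) (hqnn x) (hmom x hx)).2
  have hcont : Continuous f := by
    refine (LipschitzWith.of_dist_le_mul (K := Lip.toNNReal) fun x y => ?_).continuous
    rw [Real.dist_eq, Real.dist_eq]
    exact (hlip x y).trans
      (mul_le_mul_of_nonneg_right (Real.le_coe_toNNReal Lip) (abs_nonneg _))
  have hfq : ∀ x, 0 ≤ x → IntegrableOn (fun t => f (x - t) * q x t) (Set.Ioi 0) := by
    intro x hx
    refine (hqint x hx).bdd_mul (c := C) ?_ (Filter.Eventually.of_forall fun t => ?_)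
    · exact (hcont.comp (continuous_const.sub continuous_id)).aestronglyMeasurable
    · rw [Real.norm_eq_abs, abs_of_nonneg (hf _).1]
      exact (hf _).2
  set s : ℝ := 1 / (2 * (|Ctil| + 1)) with hs
  have hs0 : 0 < s := by positivity
  have hs1 : s ≤ 1 := by
    rw [hs, div_le_one (by positivity)]
    linarith [abs_nonneg Ctil]
  have hsC : Ctil * s ≤ 1 / 2 := by
    have e : (|Ctil| + 1) * s = 1 / 2 := by rw [hs]; field_simp
    nlinarith [le_abs_self Ctil]
  have hnear' : ∀ x, 0 ≤ x → ∫ t in Set.Ioc 0 s, q x t ≤ 1 / 2 := by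
    intro x hx
    calc ∫ t in Set.Ioc 0 s, q x t ≤ ∫ _ in Set.Ioc 0 s, Ctil :=
          setIntegral_mono_on ((hqint x hx).mono_set fun t ht => ht.1) (by simp)
            measurableSet_Ioc fun t ht => hnear x hx t ⟨ht.1.le, ht.2.trans hs1⟩
      _ ≤ 1 / 2 := by
          simp only [setIntegral_const, measureReal_def, Real.volume_Ioc, sub_zero,
            ENNReal.toReal_ofReal hs0.le, smul_eq_mul]
          linarith
  have hbdd : Filter.IsBoundedUnder (· ≤ ·) Filter.atTop f :=
    Filter.isBoundedUnder_of ⟨C, fun x => (hf x).2⟩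
  have hbdd' : Filter.IsBoundedUnder (· ≥ ·) Filter.atTop f :=
    Filter.isBoundedUnder_of ⟨0, fun x => (hf x).1⟩
  set M := Filter.limsup f Filter.atTop with hM
  have hM0 : 0 ≤ M := Filter.le_limsup_of_frequently_le
    (Filter.Frequently.of_forall fun x => (hf x).1) hbdd
  have hupper : ∀ η > 0, ∀ᶠ x in Filter.atTop, f x < M + η := fun η hη =>
    Filter.eventually_lt_of_limsup_lt (by linarith) hbdd
  have hfreq : ∀ η > 0, ∃ᶠ x in Filter.atTop, M - η < f x := fun η hη =>
    Filter.frequently_lt_of_lt_limsup hbdd'.isCoboundedUnder_le (by linarith)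
  have hlower : ∀ ε > 0, ∀ᶠ x in Filter.atTop, M - ε < f x := by
    intro ε hε
    rcases lt_or_ge (M - ε / 2) 0 with ha | ha
    · exact Filter.Eventually.of_forall fun x => by linarith [(hf x).1]
    have hlim : Filter.Tendsto (fun T : ℝ => (M - ε / 2) *
        (1 - 2 * max B 0 / (s * (β - 1)) * T ^ (1 - β))) Filter.atTop
        (nhds ((M - ε / 2) * (1 - 2 * max B 0 / (s * (β - 1)) * 0))) := by
      have h := tendsto_rpow_neg_atTop (by linarith : 0 < β - 1)
      rw [neg_sub] at h
      exact ((h.const_mul _).const_sub 1).const_mul _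
    rw [mul_zero, sub_zero, mul_one] at hlim
    obtain ⟨T, hT, hTs⟩ := ((hlim.eventually_const_lt (by linarith : M - ε < M - ε / 2)).and
      (Filter.eventually_gt_atTop s)).exists
    obtain ⟨x₀, hx₀, hwin⟩ := exists_window_ge hβ hM0 (by linarith : 0 < 2 * T)
      (half_pos hε) (fun x => (hf x).2) hC hlip hqnn hqint hqprob hpos
      hmomint hmom' hfq heq hupper hfreq
    filter_upwards [Filter.eventually_ge_atTop x₀] with y hy
    exact hT.trans_le (le_of_le_on_window hβ (le_max_right B 0) hs0 hTs ha hx₀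
      (fun x => (hf x).1) hqnn hqint hqprob hmomint hmom' hnear' hfq heq hwin y hy)
  refine ⟨M, hM0, Metric.tendsto_nhds.2 fun ε hε => ?_⟩
  filter_upwards [hupper ε hε, hlower ε hε] with x h1 h2
  rw [Real.dist_eq, abs_lt]
  constructor <;> linarith
end

section
/- Let f : ℝ → ℝ satisfy 0 ≤ f(x) ≤ C for all x and be Lipschitz with some constant 𝓛, and let (q_x)_{x ≥ 0} be a measurable family of probability densities on [0,∞) satisfying: (Tightness) for every ε > 0 there is K(ε) with ∫_0^{K(ε)} q_x(t) dt ≥ 1−ε for all x ≥ 0; (Positivity) for every T > 0 there is X(T) < ∞ such that for every δ > 0, F_T(δ) := inf over x ≥ X(T) and over measurable D ⊆ [0,T] with Lebesgue measure at least δ of ∫_D q_x(t) dt, is strictly positive. Suppose f satisfies the noisy self-averaging equation f(x) = (1−ε(x)) ∫_0^∞ f(x−t) q_x(t) dt + ε(x) Q(x) for all x ≥ 0, where ε(x) ∈ [0,1] with ε(x) → 0 as x → ∞ and 0 ≤ Q(x) ≤ C. Let M := limsup_{x→∞} f(x). Then for every T > 0 and every ε > 0 there exists K₁ such that f(x) ≥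 M − ε for every x ∈ [K₁, K₁ + T]. -/
open MeasureTheory

/-- A function whose integral over `s` equals `1` is integrable on `s`. -/
lemma integrableOn_of_setIntegral_eq_one {g : ℝ → ℝ} {s : Set ℝ}
    (h : (∫ t in s, g t) = 1) : IntegrableOn g s := by
  by_contra hg
  rw [integral_undef hg] at h
  exact zero_ne_one h

/-- A probability density on `(0, ∞)` with mass at least `1 - η` between `0` and `K` has mass at
most `η` beyond `L`, for every `L ≥ max K 0`. -/
lemma setIntegral_Ioi_le_of_tight {g : ℝ → ℝ} (hg : ∀ t, 0 ≤ g t)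
    (h1 : (∫ t in Set.Ioi (0 : ℝ), g t) = 1) {η K L : ℝ} (hL : 0 ≤ L) (hKL : K ≤ L)
    (hK : 1 - η ≤ ∫ t in (0 : ℝ)..K, g t) : (∫ t in Set.Ioi L, g t) ≤ η := by
  have hint := integrableOn_of_setIntegral_eq_one h1
  have hsplit : (∫ t in Set.Ioi (0 : ℝ), g t)
      = (∫ t in Set.Ioc 0 L, g t) + ∫ t in Set.Ioi L, g t := by
    rw [← Set.Ioc_union_Ioi_eq_Ioi hL]
    exact setIntegral_union (Set.Ioc_disjoint_Ioi le_rfl) measurableSet_Ioi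
      (hint.mono_set Set.Ioc_subset_Ioi_self) (hint.mono_set (Set.Ioi_subset_Ioi hL))
  have hle : (∫ t in (0 : ℝ)..K, g t) ≤ ∫ t in Set.Ioc 0 L, g t := by
    rcases le_total 0 K with h0 | h0
    · rw [intervalIntegral.integral_of_le h0]
      exact setIntegral_mono_set (hint.mono_set Set.Ioc_subset_Ioi_self)
        (Filter.Eventually.of_forall hg) (Set.Ioc_subset_Ioc_right hKL).eventuallyLE
    · rw [intervalIntegral.integral_of_ge h0]
      have := setIntegral_nonneg (μ := volume) (s := Set.Ioc K 0) measurableSet_Ioc fun t _ => hg t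
      have := setIntegral_nonneg (μ := volume) (s := Set.Ioc 0 L) measurableSet_Ioc fun t _ => hg t
      linarith
  linarith

/-- An average of `u` against a probability density `g`, where `u ≤ B` up to `L`, `u ≤ B - e` on
`D` and `u ≤ B + C` everywhere. -/
lemma setIntegral_mul_le_of_le_sub {u g : ℝ → ℝ} (hu : Measurable u)
    (hg : ∀ t, 0 ≤ g t) (h1 : (∫ t in Set.Ioi (0 : ℝ), g t) = 1) {B C e L : ℝ} {D : Set ℝ}
    (hD : MeasurableSet D) (hDL : D ⊆ Set.Ioc 0 L) (hL : 0 ≤ L)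
    (hu0 : ∀ t, 0 ≤ u t) (huC : ∀ t, u t ≤ B + C)
    (huB : ∀ t ∈ Set.Ioc 0 L, u t ≤ B) (huD : ∀ t ∈ D, u t ≤ B - e) :
    (∫ t in Set.Ioi (0 : ℝ), u t * g t)
      ≤ B + C * (∫ t in Set.Ioi L, g t) - e * ∫ t in D, g t := by
  have hint := integrableOn_of_setIntegral_eq_one h1
  have hD0 : D ⊆ Set.Ioi 0 := hDL.trans Set.Ioc_subset_Ioi_self
  have i1 : IntegrableOn (fun t => B * g t) (Set.Ioi 0) := hint.const_mul B
  have i2 : IntegrableOn (fun t => C * (Set.Ioi L).indicator g t) (Set.Ioi 0) :=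
    (hint.indicator measurableSet_Ioi).const_mul C
  have i3 : IntegrableOn (fun t => e * D.indicator g t) (Set.Ioi 0) :=
    (hint.indicator hD).const_mul e
  have i0 : IntegrableOn (fun t => u t * g t) (Set.Ioi 0) :=
    Integrable.bdd_mul (c := B + C) hint hu.aestronglyMeasurable
      (Filter.Eventually.of_forall fun t => by
        rw [Real.norm_eq_abs, abs_of_nonneg (hu0 t)]; exact huC t)
  have hmono : (∫ t in Set.Ioi (0 : ℝ), u t * g t)
      ≤ ∫ t in Set.Ioi (0 : ℝ),
        (B * g t + C * (Set.Ioi L).indicator g t - e * D.indicator g t) := by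
    refine setIntegral_mono_on i0 ((i1.add i2).sub i3) measurableSet_Ioi fun t ht => ?_
    rcases le_or_gt t L with htL | htL
    · have hn : t ∉ Set.Ioi L := not_lt.mpr htL
      by_cases htD : t ∈ D
      · simp only [Set.indicator_of_notMem hn, Set.indicator_of_mem htD]
        linarith [mul_le_mul_of_nonneg_right (huD t htD) (hg t)]
      · simp only [Set.indicator_of_notMem hn, Set.indicator_of_notMem htD]
        linarith [mul_le_mul_of_nonneg_right (huB t ⟨ht, htL⟩) (hg t)]
    · have htD : t ∉ D := fun h => not_le.mpr htL (hDL h).2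
      simp only [Set.indicator_of_mem (Set.mem_Ioi.mpr htL), Set.indicator_of_notMem htD]
      linarith [mul_le_mul_of_nonneg_right (huC t) (hg t)]
  have hval : (∫ t in Set.Ioi (0 : ℝ),
        (B * g t + C * (Set.Ioi L).indicator g t - e * D.indicator g t))
      = B + C * (∫ t in Set.Ioi L, g t) - e * ∫ t in D, g t := by
    have i12 : IntegrableOn (fun t => B * g t + C * (Set.Ioi L).indicator g t) (Set.Ioi 0) :=
      i1.add i2
    rw [integral_sub i12 i3, integral_add i1 i2, integral_const_mul,
      integral_const_mul, integral_const_mul, h1, setIntegral_indicator measurableSet_Ioi,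
      setIntegral_indicator hD, Set.inter_eq_right.mpr hD0,
      Set.inter_eq_right.mpr (Set.Ioi_subset_Ioi hL), mul_one]
  exact hmono.trans hval.le

/-- A point of `[0, T]` lies within `r ≤ T / 2` of every point of some `(a, a + r] ⊆ (0, T]`. -/
lemma exists_Ioc_subset_near {T r t : ℝ} (hrT : r ≤ T / 2)
    (ht : t ∈ Set.Icc 0 T) :
    ∃ a, Set.Ioc a (a + r) ⊆ Set.Ioc 0 T ∧ ∀ s ∈ Set.Ioc a (a + r), |s - t| ≤ r := by
  obtain ⟨ht0, htT⟩ := ht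
  rcases le_total t (T / 2) with h | h
  · refine ⟨t, fun s hs => ⟨?_, ?_⟩, fun s hs => abs_le.mpr ⟨?_, ?_⟩⟩ <;>
      linarith [hs.1, hs.2]
  · refine ⟨t - r, fun s hs => ⟨?_, ?_⟩, fun s hs => abs_le.mpr ⟨?_, ?_⟩⟩ <;>
      linarith [hs.1, hs.2]

/-- **Lemma (approaching the limsup).** Let `f : ℝ → ℝ` with `0 ≤ f ≤ C`, Lipschitz, and
let `(q_x)_{x ≥ 0}` be a measurable family of probability densities on `[0,∞)` which is
uniformly tight and satisfies the positivity property. If `f` satisfies the noisy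
self-averaging equation `f x = (1 − ε x) ∫_0^∞ f (x−t) q_x(t) dt + ε x * Q x` with
`ε x ∈ [0,1]`, `ε x → 0` and `0 ≤ Q ≤ C`, then, with `M = limsup_{x→∞} f x`, for every
`T > 0` and `ε' > 0` there is `K₁` with `f x ≥ M − ε'` for all `x ∈ [K₁, K₁ + T]`. -/
theorem approach_limsup_on_long_intervals
    (C Lip : ℝ)
    (f : ℝ → ℝ) (hf : ∀ x, 0 ≤ f x ∧ f x ≤ C)
    (hlip : ∀ x y : ℝ, |f x - f y| ≤ Lip * |x - y|)
    (q : ℝ → ℝ → ℝ)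
    (hqmeas : Measurable fun pr : ℝ × ℝ => q pr.1 pr.2)
    (hqnn : ∀ x t : ℝ, 0 ≤ q x t)
    (hqzero : ∀ x, 0 ≤ x → ∀ t < (0:ℝ), q x t = 0)
    (hqprob : ∀ x, 0 ≤ x → (∫ t in Set.Ioi (0:ℝ), q x t) = 1)
    (htight : ∀ ε > (0:ℝ), ∃ K : ℝ, ∀ x, 0 ≤ x → 1 - ε ≤ ∫ t in (0:ℝ)..K, q x t)
    (hpos : ∀ T > (0:ℝ), ∃ X : ℝ, ∀ δ > (0:ℝ), ∃ c > (0:ℝ), ∀ x, X ≤ x →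
      ∀ D : Set ℝ, MeasurableSet D → D ⊆ Set.Icc 0 T → δ ≤ (volume D).toReal →
        c ≤ ∫ t in D, q x t)
    (εf Q : ℝ → ℝ)
    (hε01 : ∀ x, 0 ≤ εf x ∧ εf x ≤ 1)
    (hεlim : Filter.Tendsto εf Filter.atTop (nhds 0))
    (hQ : ∀ x, 0 ≤ Q x ∧ Q x ≤ C)
    (heq : ∀ x, 0 ≤ x →
      f x = (1 - εf x) * (∫ t in Set.Ioi (0:ℝ), f (x - t) * q x t) + εf x * Q x) :
    ∀ T > (0:ℝ), ∀ ε > (0:ℝ), ∃ K₁ : ℝ,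
      ∀ x ∈ Set.Icc K₁ (K₁ + T), Filter.limsup f Filter.atTop - ε ≤ f x := by
  intro T hT ε hε
  have hLip : 0 ≤ Lip := by
    have h := (abs_nonneg _).trans (hlip 1 0)
    simpa using h
  have hC : 0 ≤ C := (hf 0).1.trans (hf 0).2
  have hfmeas : Measurable f :=
    (LipschitzWith.of_dist_le_mul (K := ⟨Lip, hLip⟩) fun x y => by
      rw [Real.dist_eq, Real.dist_eq]; exact hlip x y).continuous.measurable
  obtain ⟨r, hr, hrT, hrL⟩ : ∃ r > 0, r ≤ T / 2 ∧ Lip * r ≤ ε / 2 := by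
    refine ⟨min (T / 2) (ε / 2 / (Lip + 1)), by positivity, min_le_left _ _, ?_⟩
    have h1 : min (T / 2) (ε / 2 / (Lip + 1)) ≤ ε / 2 / (Lip + 1) := min_le_right _ _
    have h0 : 0 ≤ min (T / 2) (ε / 2 / (Lip + 1)) := by positivity
    rw [le_div_iff₀ (by positivity)] at h1
    linarith
  obtain ⟨X, hX⟩ := hpos T hT
  obtain ⟨c, hc, hcD⟩ := hX r hr
  set M := Filter.limsup f Filter.atTop
  obtain ⟨η, hη, hηc⟩ : ∃ η > 0, (2 + 2 * C) * η ≤ ε / 2 * c :=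
    ⟨ε / 2 * c / (2 + 2 * C), by positivity, by field_simp; rfl⟩
  obtain ⟨K, hK⟩ := htight η hη
  have hbdd : Filter.IsBoundedUnder (· ≤ ·) Filter.atTop f :=
    Filter.isBoundedUnder_of ⟨C, fun x => (hf x).2⟩
  have hcobdd : Filter.IsCoboundedUnder (· ≤ ·) Filter.atTop f :=
    (Filter.isBoundedUnder_of ⟨0, fun x => (hf x).1⟩ :
      Filter.IsBoundedUnder (· ≥ ·) Filter.atTop f).isCoboundedUnder_le
  obtain ⟨A, hA⟩ := Filter.eventually_atTop.mp
    (Filter.eventually_lt_of_limsup_lt (lt_add_of_pos_right M hη) hbdd)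
  have hfreq := Filter.frequently_lt_of_lt_limsup hcobdd (sub_lt_self M hη)
  obtain ⟨x₀, hx₀M, hx₀ε, hx₀⟩ := (hfreq.and_eventually
    ((hεlim.eventually_lt_const hη).and
      (Filter.eventually_ge_atTop (max (max 0 X) (A + max K T))))).exists
  have hx₀0 : 0 ≤ x₀ := (le_max_left _ _).trans ((le_max_left _ _).trans hx₀)
  have hx₀X : X ≤ x₀ := (le_max_right _ _).trans ((le_max_left _ _).trans hx₀)
  have hx₀A : A + max K T ≤ x₀ := (le_max_right _ _).trans hx₀
  have hTL : T ≤ max K T := le_max_right _ _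
  refine ⟨x₀ - T, fun x hx => ?_⟩
  by_contra! hlt
  obtain ⟨a, haT, har⟩ := exists_Ioc_subset_near (t := x₀ - x) hrT
    ⟨by linarith [hx.2], by linarith [hx.1]⟩
  have hmass := hcD x₀ hx₀X (Set.Ioc a (a + r)) measurableSet_Ioc
    (haT.trans Set.Ioc_subset_Icc_self) (by simp [hr.le])
  have htail := setIntegral_Ioi_le_of_tight (hqnn x₀) (hqprob x₀ hx₀0)
    (hT.le.trans hTL) (le_max_left K T) (hK x₀ hx₀0)
  have hMη : 0 ≤ M + η := (hf A).1.trans (hA A le_rfl).le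
  have havg := setIntegral_mul_le_of_le_sub (u := fun t => f (x₀ - t)) (B := M + η) (C := C)
    (e := ε / 2) (by fun_prop) (hqnn x₀) (hqprob x₀ hx₀0) measurableSet_Ioc
    (haT.trans (Set.Ioc_subset_Ioc_right hTL)) (hT.le.trans hTL) (fun t => (hf _).1)
    (fun t => by linarith [(hf (x₀ - t)).2])
    (fun t ht => (hA _ (by linarith [ht.2])).le)
    (fun t ht => by
      have h1 := (le_abs_self _).trans (hlip (x₀ - t) x)
      have h2 : |x₀ - t - x| ≤ r := by
        rw [abs_sub_comm, show x - (x₀ - t) = t - (x₀ - x) by ring]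
        exact har t ht
      linarith [mul_le_mul_of_nonneg_left h2 hLip])
  have hI : 0 ≤ ∫ t in Set.Ioi (0 : ℝ), f (x₀ - t) * q x₀ t :=
    integral_nonneg fun t => mul_nonneg (hf _).1 (hqnn _ _)
  have hx₀eq := heq x₀ hx₀0
  have h1 := mul_nonneg (hε01 x₀).1 hI
  have h2 : εf x₀ * Q x₀ ≤ η * C := mul_le_mul hx₀ε.le (hQ x₀).2 (hQ x₀).1 hη.le
  have h3 := mul_le_mul_of_nonneg_left htail hC
  have h4 := mul_le_mul_of_nonneg_left hmass (half_pos hε).le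
  linarith
end

section
/- Let f : ℝ → ℝ satisfy 0 ≤ f(x) ≤ C for all x and be Lipschitz with some constant 𝓛, and let (q_x)_{x ≥ 0} be a measurable family of probability densities on [0,∞) satisfying: (Tightness) for every ε > 0 there is K(ε) with ∫_0^{K(ε)} q_x(t) dt ≥ 1−ε for all x ≥ 0; (Positivity) for every T > 0 there is X(T) < ∞ such that for every δ > 0, F_T(δ) := inf over x ≥ X(T) and over measurable D ⊆ [0,T] with Lebesgue measure at least δ of ∫_D q_x(t) dt, is strictly positive. Suppose f satisfies the noisy self-averaging equation f(x) = (1−ε(x)) ∫_0^∞ f(x−t) q_x(t) dt + ε(x) Q(x) for all x ≥ 0, where ε(x) ∈ [0,1] with ε(x) → 0 as x → ∞ and 0 ≤ Q(x) ≤ C. Let m := liminf_{x→∞} f(x). Then for every T > 0 and every ε > 0 there exists K₂ such that f(x) ≤ m + ε for every x ∈ [K₂, K₂ + T]. -/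
open MeasureTheory

/-- If a probability density on `[0, ∞)` has mass at least `1 - η` on `[0, K]`, then its mass on
`(max K 0, ∞)` is at most `η`. -/
theorem integral_Ioi_max_le_of_le_integral {p : ℝ → ℝ} (hp : ∀ t, 0 ≤ p t)
    (hpint : IntegrableOn p (Set.Ioi 0)) (hp1 : (∫ t in Set.Ioi (0:ℝ), p t) = 1)
    {K η : ℝ} (hK : 1 - η ≤ ∫ t in (0:ℝ)..K, p t) :
    (∫ t in Set.Ioi (max K 0), p t) ≤ η := by
  rcases le_total K 0 with h | h
  · have h1 : (∫ t in (0:ℝ)..K, p t) ≤ 0 := by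
      rw [intervalIntegral.integral_symm, neg_nonpos]
      exact intervalIntegral.integral_nonneg h fun t _ => hp t
    rw [max_eq_right h]
    linarith
  · rw [max_eq_left h]
    have hsplit : (∫ t in Set.Ioi (0:ℝ), p t) =
        (∫ t in Set.Ioc 0 K, p t) + ∫ t in Set.Ioi K, p t := by
      rw [← setIntegral_union Set.Ioc_disjoint_Ioi_same measurableSet_Ioi
        (hpint.mono_set Set.Ioc_subset_Ioi_self) (hpint.mono_set (Set.Ioi_subset_Ioi h)),
        Set.Ioc_union_Ioi_eq_Ioi h]
    rw [intervalIntegral.integral_of_le h] at hK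
    linarith

/-- Lower bound for the average of `g` against a probability density `p` on `[0, ∞)`, when
`g` is at least `a` on `[0, K]`, at least `a + b` on `D`, and at least `a - C` everywhere. -/
theorem le_integral_mul_of_le_on {p g : ℝ → ℝ} {a b C K : ℝ} {D : Set ℝ}
    (hp : ∀ t, 0 ≤ p t) (hpint : IntegrableOn p (Set.Ioi 0))
    (hp1 : (∫ t in Set.Ioi (0:ℝ), p t) = 1)
    (hgp : IntegrableOn (fun t => g t * p t) (Set.Ioi 0))
    (hC : 0 ≤ C) (hK0 : 0 ≤ K) (hDm : MeasurableSet D) (hD : D ⊆ Set.Ici 0)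
    (hgC : ∀ t, a - C ≤ g t) (hgK : ∀ t, t ∈ Set.Icc 0 K → a ≤ g t)
    (hgD : ∀ t, t ∈ D → a + b ≤ g t) :
    a + b * (∫ t in D, p t) - C * (∫ t in Set.Ioi K, p t) ≤
      ∫ t in Set.Ioi (0:ℝ), g t * p t := by
  rw [← integral_Ici_eq_integral_Ioi] at hp1
  rw [← integral_Ici_eq_integral_Ioi (x := (0:ℝ))]
  rw [← integrableOn_Ici_iff_integrableOn_Ioi] at hpint hgp
  have hKs : Set.Ioi K ⊆ Set.Ici 0 := fun t ht => hK0.trans (le_of_lt ht)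
  have e1 : (∫ t in D, p t) = ∫ t in Set.Ici (0:ℝ), D.indicator p t := by
    rw [setIntegral_indicator hDm, Set.inter_eq_right.2 hD]
  have e2 : (∫ t in Set.Ioi K, p t) = ∫ t in Set.Ici (0:ℝ), (Set.Ioi K).indicator p t := by
    rw [setIntegral_indicator measurableSet_Ioi, Set.inter_eq_right.2 hKs]
  have i1 : IntegrableOn (D.indicator p) (Set.Ici 0) := hpint.indicator hDm
  have i2 : IntegrableOn ((Set.Ioi K).indicator p) (Set.Ici 0) := hpint.indicator measurableSet_Ioi
  have i3 : IntegrableOn (fun t => a * p t + b * D.indicator p t) (Set.Ici 0) :=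
    (hpint.const_mul a).add (i1.const_mul b)
  have e3 : a + b * (∫ t in D, p t) - C * (∫ t in Set.Ioi K, p t) =
      ∫ t in Set.Ici (0:ℝ),
        (a * p t + b * D.indicator p t - C * (Set.Ioi K).indicator p t) := by
    rw [integral_sub i3 (i2.const_mul C),
      integral_add (hpint.const_mul a) (i1.const_mul b), integral_const_mul, integral_const_mul,
      integral_const_mul, hp1, e1, e2, mul_one]
  rw [e3]
  refine setIntegral_mono_on (i3.sub (i2.const_mul C)) hgp measurableSet_Ici fun t ht => ?_
  have hpt := hp t
  by_cases h1 : t ∈ D <;> by_cases h2 : t ∈ Set.Ioi K <;>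
    simp only [Set.indicator_of_mem, Set.indicator_of_notMem, h1, h2, not_false_eq_true]
  · nlinarith [mul_le_mul_of_nonneg_right (hgD t h1) hpt, mul_nonneg hC hpt]
  · nlinarith [mul_le_mul_of_nonneg_right (hgD t h1) hpt]
  · nlinarith [mul_le_mul_of_nonneg_right (hgC t) hpt]
  · nlinarith [mul_le_mul_of_nonneg_right (hgK t ⟨ht, not_lt.1 h2⟩) hpt]

/-- **Lemma (approaching the liminf).** Let `f : ℝ → ℝ` with `0 ≤ f ≤ C`, Lipschitz, and
let `(q_x)_{x ≥ 0}` be a measurable family of probability densities on `[0,∞)` which is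
uniformly tight and satisfies the positivity property. If `f` satisfies the noisy
self-averaging equation `f x = (1 − ε x) ∫_0^∞ f (x−t) q_x(t) dt + ε x * Q x` with
`ε x ∈ [0,1]`, `ε x → 0` and `0 ≤ Q ≤ C`, then, with `m = liminf_{x→∞} f x`, for every
`T > 0` and `ε' > 0` there is `K₂` with `f x ≤ m + ε'` for all `x ∈ [K₂, K₂ + T]`. -/
theorem approach_liminf_on_long_intervals
    (C Lip : ℝ)
    (f : ℝ → ℝ) (hf : ∀ x, 0 ≤ f x ∧ f x ≤ C)
    (hlip : ∀ x y : ℝ, |f x - f y| ≤ Lip * |x - y|)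
    (q : ℝ → ℝ → ℝ)
    (hqmeas : Measurable fun pr : ℝ × ℝ => q pr.1 pr.2)
    (hqnn : ∀ x t : ℝ, 0 ≤ q x t)
    (hqzero : ∀ x, 0 ≤ x → ∀ t < (0:ℝ), q x t = 0)
    (hqprob : ∀ x, 0 ≤ x → (∫ t in Set.Ioi (0:ℝ), q x t) = 1)
    (htight : ∀ ε > (0:ℝ), ∃ K : ℝ, ∀ x, 0 ≤ x → 1 - ε ≤ ∫ t in (0:ℝ)..K, q x t)
    (hpos : ∀ T > (0:ℝ), ∃ X : ℝ, ∀ δ > (0:ℝ), ∃ c > (0:ℝ), ∀ x, X ≤ x →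
      ∀ D : Set ℝ, MeasurableSet D → D ⊆ Set.Icc 0 T → δ ≤ (volume D).toReal →
        c ≤ ∫ t in D, q x t)
    (εf Q : ℝ → ℝ)
    (hε01 : ∀ x, 0 ≤ εf x ∧ εf x ≤ 1)
    (hεlim : Filter.Tendsto εf Filter.atTop (nhds 0))
    (hQ : ∀ x, 0 ≤ Q x ∧ Q x ≤ C)
    (heq : ∀ x, 0 ≤ x →
      f x = (1 - εf x) * (∫ t in Set.Ioi (0:ℝ), f (x - t) * q x t) + εf x * Q x) :
    ∀ T > (0:ℝ), ∀ ε > (0:ℝ), ∃ K₂ : ℝ,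
      ∀ x ∈ Set.Icc K₂ (K₂ + T), f x ≤ Filter.liminf f Filter.atTop + ε := by
  intro T hT ε hε
  set m := Filter.liminf f Filter.atTop with hm
  have hC : 0 ≤ C := (hf 0).1.trans (hf 0).2
  have hL : 0 < |Lip| + 1 := by positivity
  have hlip' : ∀ x y : ℝ, |f x - f y| ≤ (|Lip| + 1) * |x - y| := fun x y =>
    (hlip x y).trans (mul_le_mul_of_nonneg_right (by linarith [le_abs_self Lip]) (abs_nonneg _))
  have hcont : Continuous f :=
    (LipschitzWith.of_dist_le_mul (K := ⟨|Lip| + 1, hL.le⟩) hlip').continuous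
  have hbelow : Filter.IsBoundedUnder (· ≥ ·) Filter.atTop f :=
    Filter.isBoundedUnder_of ⟨0, fun x => (hf x).1⟩
  have habove : Filter.IsBoundedUnder (· ≤ ·) Filter.atTop f :=
    Filter.isBoundedUnder_of ⟨C, fun x => (hf x).2⟩
  have hmC : m ≤ C := by
    refine Filter.liminf_le_of_frequently_le ?_ hbelow
    exact Filter.Frequently.of_forall fun x => (hf x).2
  obtain ⟨δ, hδ0, hδT, hδL⟩ : ∃ δ > (0:ℝ), δ ≤ T ∧ (|Lip| + 1) * δ ≤ ε / 2 :=
    ⟨min T (ε / 2 / (|Lip| + 1)), by positivity, min_le_left _ _, by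
      calc (|Lip| + 1) * min T (ε / 2 / (|Lip| + 1))
          ≤ (|Lip| + 1) * (ε / 2 / (|Lip| + 1)) := by gcongr; exact min_le_right _ _
        _ = ε / 2 := by field_simp⟩
  obtain ⟨X, hX⟩ := hpos T hT
  obtain ⟨c, hc, hcD⟩ := hX δ hδ0
  obtain ⟨s, hs, hsc⟩ : ∃ s > (0:ℝ), (2 + 2 * C) * s ≤ ε / 2 * c :=
    ⟨ε / 2 * c / (2 + 2 * C), by positivity, by field_simp; exact le_rfl⟩
  obtain ⟨K, hK⟩ := htight s hs
  obtain ⟨K₀, hK₀⟩ := Filter.eventually_atTop.1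
    (Filter.eventually_lt_of_lt_liminf (show m - s < m by linarith) hbelow)
  have hfreq : ∃ᶠ x in Filter.atTop, f x < m + s :=
    Filter.frequently_lt_of_liminf_lt habove.isCoboundedUnder_ge (by linarith)
  obtain ⟨x, hfx, hεx, hx0, hxX, hxT, hxK⟩ := (hfreq.and_eventually
    ((hεlim.eventually (gt_mem_nhds hs)).and
      ((Filter.eventually_ge_atTop 0).and ((Filter.eventually_ge_atTop X).and
        ((Filter.eventually_ge_atTop (K₀ + T)).and
          (Filter.eventually_ge_atTop (K₀ + max K 0))))))).exists
  refine ⟨x - T, fun y hy => ?_⟩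
  by_contra! hfy
  have hy1 : x - T ≤ y := hy.1
  have hy2 : y ≤ x := by linarith [hy.2]
  have hqint : IntegrableOn (q x) (Set.Ioi 0) := by
    by_contra h
    have := hqprob x hx0
    rw [integral_undef h] at this
    exact zero_ne_one this
  have hfqint : IntegrableOn (fun t => f (x - t) * q x t) (Set.Ioi 0) :=
    Integrable.bdd_mul (c := C) hqint
      (hcont.comp (continuous_const.sub continuous_id)).aestronglyMeasurable
      (Filter.Eventually.of_forall fun t => by
        rw [Real.norm_eq_abs, abs_of_nonneg (hf _).1]; exact (hf _).2)
  have htail := integral_Ioi_max_le_of_le_integral (hqnn x) hqint (hqprob x hx0) (hK x hx0)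
  obtain ⟨a, ha0, haT, hat, hta⟩ :
      ∃ a, 0 ≤ a ∧ a + δ ≤ T ∧ a ≤ x - y ∧ x - y ≤ a + δ := by
    rcases le_total (x - y) (T - δ) with h | h
    · exact ⟨x - y, by linarith, by linarith, le_rfl, by linarith⟩
    · exact ⟨T - δ, by linarith, by linarith, h, by linarith⟩
  have hDT : Set.Icc a (a + δ) ⊆ Set.Icc 0 T := Set.Icc_subset_Icc ha0 haT
  have hmass := hcD x hxX (Set.Icc a (a + δ)) measurableSet_Icc hDT
    (by rw [Real.volume_Icc, add_sub_cancel_left, ENNReal.toReal_ofReal hδ0.le])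
  have hlow := le_integral_mul_of_le_on (a := m - s) (b := ε / 2) (C := C) (K := max K 0)
    (g := fun t => f (x - t)) (hqnn x) hqint (hqprob x hx0) hfqint hC (le_max_right _ _)
    measurableSet_Icc (hDT.trans Set.Icc_subset_Ici_self)
    (fun t => by linarith [(hf (x - t)).1])
    (fun t ht => (hK₀ _ (by linarith [ht.2])).le)
    (fun t ht => by
      have h1 : |y - (x - t)| ≤ δ := by
        rw [abs_le]; constructor <;> linarith [ht.1, ht.2]
      have h2 := (le_abs_self _).trans ((hlip' y (x - t)).trans
        ((mul_le_mul_of_nonneg_left h1 hL.le).trans hδL))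
      linarith)
  have hup : (∫ t in Set.Ioi (0:ℝ), f (x - t) * q x t) ≤ C := by
    calc (∫ t in Set.Ioi (0:ℝ), f (x - t) * q x t)
        ≤ ∫ t in Set.Ioi (0:ℝ), C * q x t :=
          integral_mono hfqint (hqint.const_mul C)
            fun t => mul_le_mul_of_nonneg_right (hf _).2 (hqnn x t)
      _ = C := by rw [integral_const_mul, hqprob x hx0, mul_one]
  have hfxeq := heq x hx0
  have h1 := mul_le_mul_of_nonneg_left hmass (half_pos hε).le
  have h2 := mul_le_mul_of_nonneg_left htail hC
  have h3 := mul_le_mul_of_nonneg_left hup (hε01 x).1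
  have h4 := mul_nonneg (hε01 x).1 (hQ x).1
  have h5 := mul_le_mul_of_nonneg_right hεx.le hC
  linarith
end

section
/- Let p be a bounded probability density on (0,∞), and let f : ℝ → ℝ be nonnegative and bounded with (f ∗ p)(x) = f(x) for all x ≥ 0. Let φ(x) = f(x) for x < 0 and φ(x) = 0 for x ≥ 0, and let g(x) = (φ ∗ p)(x)·1_{x ≥ 0}. Then the renewal series s(u) = Σ_{n=1}^∞ p^{∗n}(u) converges for every u ≥ 0, and for every x > 0 one has f(x) = (φ ∗ p)(x) + ∫_0^x g(x−u) s(u) du. -/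
open MeasureTheory

/-- Convolution on `ℝ` (with respect to Lebesgue measure). -/
noncomputable def conv (a b : ℝ → ℝ) : ℝ → ℝ := fun x => ∫ t, a (x - t) * b t

/-- `convPow p n` is the `(n+1)`-fold convolution power `p^{∗(n+1)}` of `p`:
`convPow p 0 = p` and `convPow p (n+1) = (convPow p n) ∗ p`. -/
noncomputable def convPow (p : ℝ → ℝ) : ℕ → ℝ → ℝ
  | 0 => p
  | n + 1 => conv (convPow p n) p

open scoped Convolution

lemma conv_eq_convolution (a b : ℝ → ℝ) :
    conv a b = a ⋆[ContinuousLinearMap.mul ℝ ℝ, volume] b := by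
  ext x
  exact convolution_mul_swap.symm

lemma conv_comm (a b : ℝ → ℝ) : conv a b = conv b a := by
  rw [conv_eq_convolution b a]
  ext x
  simp only [conv, convolution_def, ContinuousLinearMap.mul_apply']
  exact integral_congr_ae (.of_forall fun t => mul_comm _ _)

lemma measurable_conv {a b : ℝ → ℝ} (ha : Measurable a) (hb : Measurable b) :
    Measurable (conv a b) := by
  have h : StronglyMeasurable (Function.uncurry fun x t : ℝ => a (x - t) * b t) :=
    ((ha.comp (measurable_fst.sub measurable_snd)).mul
      (hb.comp measurable_snd)).stronglyMeasurable
  exact h.integral_prod_right.measurable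

lemma integrable_conv {a b : ℝ → ℝ} (ha : Integrable a) (hb : Integrable b) :
    Integrable (conv a b) := by
  rw [conv_eq_convolution]
  exact ha.integrable_convolution _ hb

lemma conv_nonneg {a b : ℝ → ℝ} (ha : ∀ x, 0 ≤ a x) (hb : ∀ x, 0 ≤ b x) (x : ℝ) :
    0 ≤ conv a b x :=
  integral_nonneg fun _ => mul_nonneg (ha _) (hb _)

lemma conv_eq_zero {a b : ℝ → ℝ} (ha : ∀ x < 0, a x = 0) (hb : ∀ x ≤ 0, b x = 0)
    {x : ℝ} (hx : x ≤ 0) : conv a b x = 0 := by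
  refine integral_eq_zero_of_ae (.of_forall fun t => ?_)
  rcases le_or_gt t 0 with ht | ht
  · simp [hb t ht]
  · simp [ha (x - t) (by linarith)]

lemma integrable_conv_integrand {a b : ℝ → ℝ} {B : ℝ} (ha : Measurable a)
    (haB : ∀ x, |a x| ≤ B) (hb : Integrable b) (x : ℝ) :
    Integrable fun t => a (x - t) * b t :=
  hb.bdd_mul (ha.comp (measurable_const.sub measurable_id)).aestronglyMeasurable
    (.of_forall fun _ => haB _)

lemma conv_add_left {a a' b : ℝ → ℝ} {B B' : ℝ} (ha : Measurable a) (ha' : Measurable a')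
    (haB : ∀ x, |a x| ≤ B) (haB' : ∀ x, |a' x| ≤ B') (hb : Integrable b) (x : ℝ) :
    conv (fun y => a y + a' y) b x = conv a b x + conv a' b x := by
  simp only [conv, add_mul]
  exact integral_add (integrable_conv_integrand ha haB hb x)
    (integrable_conv_integrand ha' haB' hb x)

lemma conv_assoc {a b c : ℝ → ℝ} {B : ℝ} (ha : Measurable a) (haB : ∀ x, |a x| ≤ B)
    (hb : Integrable b) (hc : Integrable c) :
    conv (conv a b) c = conv a (conv b c) := by
  ext x
  simp only [conv_eq_convolution]
  refine convolution_assoc _ _ _ _ (fun x y z => mul_assoc x y z) ha.aestronglyMeasurable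
    hb.aestronglyMeasurable hc.aestronglyMeasurable (.of_forall fun y => ?_)
    (hb.norm.ae_convolution_exists _ hc.norm) ?_
  · exact (hb.comp_sub_left y).bdd_mul ha.aestronglyMeasurable (.of_forall haB)
  · exact ((hb.norm.integrable_convolution (ContinuousLinearMap.mul ℝ ℝ)
      hc.norm).comp_sub_left x).bdd_mul (c := B) ha.norm.aestronglyMeasurable
      (.of_forall fun y => by simpa using haB y)

/-- Convolution with a density bounded by `A` halves the weighted bound `a x ≤ C e^{2Ax}`. -/
lemma conv_le_half_mul_exp {a p : ℝ → ℝ} {A C : ℝ} (hA : 0 < A) (hC : 0 ≤ C)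
    (hp : ∀ t, 0 ≤ p t) (hp0 : ∀ t ≤ (0 : ℝ), p t = 0) (hpA : ∀ t, p t ≤ A)
    (ha : ∀ x, 0 ≤ a x) (haC : ∀ x, a x ≤ C * Real.exp (2 * A * x)) (x : ℝ) :
    conv a p x ≤ C / 2 * Real.exp (2 * A * x) := by
  have hint : IntegrableOn (fun t => C * A * Real.exp (2 * A * x) * Real.exp (-(2 * A) * t))
      (Set.Ioi 0) :=
    (integrableOn_exp_mul_Ioi (by linarith) 0).const_mul _
  calc conv a p x
      ≤ ∫ t, (Set.Ioi (0 : ℝ)).indicator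
          (fun t => C * A * Real.exp (2 * A * x) * Real.exp (-(2 * A) * t)) t := by
        refine integral_mono_of_nonneg (.of_forall fun t => mul_nonneg (ha _) (hp _))
          (hint.integrable_indicator measurableSet_Ioi) (.of_forall fun t => ?_)
        rcases le_or_gt t 0 with ht | ht
        · simp [hp0 t ht, not_lt.mpr ht]
        · rw [Set.indicator_of_mem (Set.mem_Ioi.mpr ht), mul_assoc, ← Real.exp_add]
          calc a (x - t) * p t ≤ (C * Real.exp (2 * A * (x - t))) * A :=
                mul_le_mul (haC _) (hpA t) (hp t) (by positivity)
            _ = _ := by ring_nf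
    _ = C / 2 * Real.exp (2 * A * x) := by
        rw [integral_indicator measurableSet_Ioi, integral_const_mul,
          integral_exp_mul_Ioi (by linarith)]
        simp only [mul_zero, Real.exp_zero]
        field_simp

lemma convPow_nonneg {p : ℝ → ℝ} (hp : ∀ t, 0 ≤ p t) (n : ℕ) (x : ℝ) : 0 ≤ convPow p n x := by
  induction n generalizing x with
  | zero => exact hp x
  | succ n ih => exact conv_nonneg ih hp x

lemma measurable_convPow {p : ℝ → ℝ} (hp : Measurable p) (n : ℕ) : Measurable (convPow p n) := by
  induction n with
  | zero => exact hp
  | succ n ih => exact measurable_conv ih hp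

lemma integrable_convPow {p : ℝ → ℝ} (hp : Integrable p) (n : ℕ) : Integrable (convPow p n) := by
  induction n with
  | zero => exact hp
  | succ n ih => exact integrable_conv ih hp

lemma convPow_eq_zero {p : ℝ → ℝ} (hp0 : ∀ t ≤ (0 : ℝ), p t = 0) (n : ℕ) {x : ℝ} (hx : x ≤ 0) :
    convPow p n x = 0 := by
  induction n generalizing x with
  | zero => exact hp0 x hx
  | succ n ih => exact conv_eq_zero (fun y hy => ih hy.le) hp0 hx

lemma convPow_le {p : ℝ → ℝ} {A : ℝ} (hA : 0 < A) (hp : ∀ t, 0 ≤ p t)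
    (hp0 : ∀ t ≤ (0 : ℝ), p t = 0) (hpA : ∀ t, p t ≤ A) (n : ℕ) (x : ℝ) :
    convPow p n x ≤ A / 2 ^ n * Real.exp (2 * A * x) := by
  induction n generalizing x with
  | zero =>
    rcases le_or_gt x 0 with hx | hx
    · rw [convPow_eq_zero hp0 0 hx]
      positivity
    · have : 1 ≤ Real.exp (2 * A * x) := Real.one_le_exp (by positivity)
      simp only [pow_zero, div_one]
      exact (hpA x).trans (le_mul_of_one_le_right hA.le this)
  | succ n ih =>
    rw [pow_succ, ← div_div]
    exact conv_le_half_mul_exp hA (by positivity) hp hp0 hpA (convPow_nonneg hp n) ih x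

lemma summable_convPow {p : ℝ → ℝ} {A : ℝ} (hA : 0 < A) (hp : ∀ t, 0 ≤ p t)
    (hp0 : ∀ t ≤ (0 : ℝ), p t = 0) (hpA : ∀ t, p t ≤ A) (x : ℝ) :
    Summable fun n => convPow p n x := by
  refine .of_nonneg_of_le (fun n => convPow_nonneg hp n x) (convPow_le hA hp hp0 hpA · x) ?_
  exact (summable_geometric_two' A |>.mul_left 2 |>.congr fun n => by ring).mul_right _

/-- Solution of the renewal equation `h = g + h ∗ p` as a series. -/
lemma hasSum_conv_convPow {h g p : ℝ → ℝ} {A B : ℝ} (hA : 0 < A)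
    (hpm : Measurable p) (hpi : Integrable p) (hp : ∀ t, 0 ≤ p t)
    (hp0 : ∀ t ≤ (0 : ℝ), p t = 0) (hpA : ∀ t, p t ≤ A)
    (hh : Measurable h) (hh0 : ∀ x, 0 ≤ h x) (hhB : ∀ x, h x ≤ B)
    (hhneg : ∀ x < 0, h x = 0) (hg : Measurable g) (hg0 : ∀ x, 0 ≤ g x)
    (hren : ∀ x, h x = g x + conv h p x) (x : ℝ) :
    HasSum (fun n => conv g (convPow p n) x) (conv h p x) := by
  have hB : 0 ≤ B := (hh0 0).trans (hhB 0)
  have hhabs : ∀ x, |h x| ≤ B := fun x => by rw [abs_of_nonneg (hh0 x)]; exact hhB x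
  have hgabs : ∀ x, |g x| ≤ B := fun x => by
    rw [abs_of_nonneg (hg0 x)]
    linarith [hren x, hhB x, conv_nonneg hh0 hp x]
  have hcabs : ∀ x, |conv h p x| ≤ B := fun x => by
    rw [abs_of_nonneg (conv_nonneg hh0 hp x)]
    linarith [hren x, hhB x, hg0 x]
  have hsucc : ∀ n, conv h (convPow p n) x =
      conv g (convPow p n) x + conv h (convPow p (n + 1)) x := fun n => by
    have e : h = fun y => g y + conv h p y := funext hren
    conv_lhs => rw [e]
    rw [conv_add_left hg (measurable_conv hh hpm) hgabs hcabs (integrable_convPow hpi n),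
      conv_assoc hh hhabs hpi (integrable_convPow hpi n), conv_comm p]
    rfl
  have hbound : ∀ n x, conv h (convPow p n) x ≤ B / 2 / 2 ^ n * Real.exp (2 * A * x) := by
    intro n
    induction n with
    | zero =>
      intro x
      rw [pow_zero, div_one]
      refine conv_le_half_mul_exp hA hB hp hp0 hpA hh0 (fun y => ?_) x
      rcases lt_or_ge y 0 with hy | hy
      · rw [hhneg y hy]
        positivity
      · exact (hhB y).trans (le_mul_of_one_le_right hB (Real.one_le_exp (by positivity)))
    | succ n ih =>
      intro x
      rw [convPow, ← conv_assoc hh hhabs (integrable_convPow hpi n) hpi, pow_succ, ← div_div]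
      exact conv_le_half_mul_exp hA (by positivity) hp hp0 hpA
        (conv_nonneg hh0 (convPow_nonneg hp n)) ih x
  have hlim : Filter.Tendsto (fun n => conv h (convPow p n) x) .atTop (nhds 0) := by
    refine squeeze_zero (fun n => conv_nonneg hh0 (convPow_nonneg hp n) x) (hbound · x) ?_
    have := (summable_geometric_two' (B / 2)).tendsto_atTop_zero.const_mul
      (2 * Real.exp (2 * A * x))
    rw [mul_zero] at this
    exact this.congr fun n => by ring
  rw [hasSum_iff_tendsto_nat_of_nonneg
    fun n => conv_nonneg hg0 (convPow_nonneg hp n) x]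
  have hpartial : ∀ N, ∑ n ∈ Finset.range N, conv g (convPow p n) x =
      conv h p x - conv h (convPow p N) x := fun N => by
    induction N with
    | zero => simp [convPow]
    | succ N ih => rw [Finset.sum_range_succ, ih, hsucc N]; ring
  simp only [hpartial]
  simpa using hlim.const_sub (conv h p x)

lemma conv_eq_intervalIntegral {a b : ℝ → ℝ} (ha : ∀ x < 0, a x = 0) (hb : ∀ x ≤ 0, b x = 0)
    {x : ℝ} (hx : 0 ≤ x) : conv a b x = ∫ u in (0 : ℝ)..x, a (x - u) * b u := by
  rw [intervalIntegral.integral_of_le hx]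
  refine (setIntegral_eq_integral_of_forall_compl_eq_zero fun u hu => ?_).symm
  rcases le_or_gt u 0 with h0 | h0
  · simp [hb u h0]
  · have : x < u := not_le.mp fun h => hu ⟨h0, h⟩
    simp [ha (x - u) (by linarith)]

lemma hasSum_intervalIntegral_convPow {g p : ℝ → ℝ} {A B : ℝ} (hA : 0 < A)
    (hpm : Measurable p) (hp : ∀ t, 0 ≤ p t)
    (hp0 : ∀ t ≤ (0 : ℝ), p t = 0) (hpA : ∀ t, p t ≤ A)
    (hg : Measurable g) (hgB : ∀ x, |g x| ≤ B) {x : ℝ} (hx : 0 ≤ x) :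
    HasSum (fun n => ∫ u in (0 : ℝ)..x, g (x - u) * convPow p n u)
      (∫ u in (0 : ℝ)..x, g (x - u) * ∑' n, convPow p n u) := by
  have hB : 0 ≤ B := (abs_nonneg _).trans (hgB 0)
  have hsum : Summable fun n : ℕ => B * (A / 2 ^ n * Real.exp (2 * A * x)) :=
    ((summable_geometric_two' A |>.mul_left 2 |>.congr fun n => by ring).mul_right _).mul_left _
  refine intervalIntegral.hasSum_integral_of_dominated_convergence
    (fun n _ => B * (A / 2 ^ n * Real.exp (2 * A * x)))
    (fun n => ((hg.comp (measurable_const.sub measurable_id)).mul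
      (measurable_convPow hpm n)).aestronglyMeasurable)
    (fun n => .of_forall fun u hu => ?_) (.of_forall fun _ _ => hsum)
    intervalIntegrable_const
    (.of_forall fun u _ => (summable_convPow hA hp hp0 hpA u).hasSum.mul_left _)
  rw [Set.uIoc_of_le hx] at hu
  rw [norm_mul, Real.norm_eq_abs, Real.norm_eq_abs, abs_of_nonneg (convPow_nonneg hp n u)]
  refine mul_le_mul (hgB _) ((convPow_le hA hp hp0 hpA n u).trans ?_)
    (convPow_nonneg hp n u) hB
  have := hu.2
  gcongr

/-- **Lemma (renewal series representation).** Let `p` be a bounded probability density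
on `(0,∞)` (extended by `0` to nonpositive arguments), and let `f : ℝ → ℝ` be
nonnegative, bounded, measurable with `(f ∗ p)(x) = f x` for all `x ≥ 0`. Let
`φ = f·1_{(−∞,0)}`, `g = (φ ∗ p)·1_{[0,∞)}` and `s(u) = Σ_{n=1}^∞ p^{∗n}(u)`. Then the
renewal series converges for every `u ≥ 0`, and for every `x > 0`,
`f x = (φ ∗ p)(x) + ∫_0^x g(x−u) s(u) du`. -/
theorem renewal_series_representation
    (p : ℝ → ℝ) (hpmeas : Measurable p)
    (hpnn : ∀ t, 0 ≤ p t) (hp0 : ∀ t ≤ (0:ℝ), p t = 0)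
    (hpbdd : ∃ A : ℝ, ∀ t, p t ≤ A)
    (hnorm : (∫ t in Set.Ioi (0:ℝ), p t) = 1)
    (f : ℝ → ℝ) (hfmeas : Measurable f)
    (hfnn : ∀ x, 0 ≤ f x) (hfbd : ∃ A : ℝ, ∀ x, f x ≤ A)
    (heq : ∀ x, 0 ≤ x → conv f p x = f x)
    (φ g s : ℝ → ℝ)
    (hφ : ∀ x, φ x = if x < 0 then f x else 0)
    (hg : ∀ x, g x = if 0 ≤ x then conv φ p x else 0)
    (hs : ∀ u, s u = ∑' n : ℕ, convPow p n u) :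
    (∀ u, 0 ≤ u → Summable fun n : ℕ => convPow p n u) ∧
      ∀ x, 0 < x → f x = conv φ p x + ∫ u in (0:ℝ)..x, g (x - u) * s u := by
  obtain ⟨A, hpA, hA⟩ : ∃ A : ℝ, (∀ t, p t ≤ A) ∧ 0 < A := by
    obtain ⟨A, hA⟩ := hpbdd
    exact ⟨max A 1, fun t => (hA t).trans (le_max_left _ _), by positivity⟩
  obtain ⟨B, hfB⟩ := hfbd
  have hB : 0 ≤ B := (hfnn 0).trans (hfB 0)
  have hpi : Integrable p := by
    have hpi' : IntegrableOn p (Set.Ioi 0) :=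
      not_imp_comm.mp integral_undef (by rw [hnorm]; exact one_ne_zero)
    exact hpi'.integrable_of_forall_notMem_eq_zero fun t ht => hp0 t (not_lt.mp ht)
  refine ⟨fun u _ => summable_convPow hA hpnn hp0 hpA u, fun x hx => ?_⟩
  set h : ℝ → ℝ := fun x => if x < 0 then 0 else f x with hh
  have hφm : Measurable φ := by
    rw [funext hφ]
    exact hfmeas.ite measurableSet_Iio measurable_const
  have hgm : Measurable g := by
    rw [funext hg]
    exact (measurable_conv hφm hpmeas).ite measurableSet_Ici measurable_const
  have hhm : Measurable h := measurable_const.ite measurableSet_Iio hfmeas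
  have hφ0 : ∀ x, 0 ≤ φ x := fun x => by rw [hφ]; split_ifs; exacts [hfnn x, le_rfl]
  have hh0 : ∀ x, 0 ≤ h x := fun x => by simp only [hh]; split_ifs; exacts [le_rfl, hfnn x]
  have hg0 : ∀ x, 0 ≤ g x := fun x => by
    rw [hg]; split_ifs; exacts [conv_nonneg hφ0 hpnn x, le_rfl]
  have hφB : ∀ x, φ x ≤ B := fun x => by rw [hφ]; split_ifs; exacts [hfB x, hB]
  have hhB : ∀ x, h x ≤ B := fun x => by simp only [hh]; split_ifs; exacts [hB, hfB x]
  have hhneg : ∀ x < 0, h x = 0 := fun x hx => if_pos hx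
  have hgneg : ∀ x < 0, g x = 0 := fun x hx => by rw [hg, if_neg (not_le.mpr hx)]
  have hsplit : f = fun y => φ y + h y := by
    ext y
    simp only [hφ, hh]
    split_ifs <;> simp
  have hren : ∀ x, h x = g x + conv h p x := fun x => by
    rcases lt_or_ge x 0 with hx | hx
    · rw [hhneg x hx, hgneg x hx, conv_eq_zero hhneg hp0 hx.le, add_zero]
    · rw [hg, if_pos hx, ← conv_add_left hφm hhm (fun y => (abs_of_nonneg (hφ0 y)).trans_le (hφB y))
        (fun y => (abs_of_nonneg (hh0 y)).trans_le (hhB y)) hpi, ← hsplit, heq x hx]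
      exact if_neg (not_lt.mpr hx)
  have hgabs : ∀ x, |g x| ≤ B := fun x => by
    rw [abs_of_nonneg (hg0 x)]
    linarith [hren x, hhB x, conv_nonneg hh0 hpnn x]
  have hseries := hasSum_conv_convPow hA hpmeas hpi hpnn hp0 hpA hhm hh0 hhB hhneg hgm hg0 hren x
  simp only [conv_eq_intervalIntegral hgneg (fun _ => convPow_eq_zero hp0 _) hx.le] at hseries
  have hint := hasSum_intervalIntegral_convPow hA hpmeas hpnn hp0 hpA hgm hgabs hx.le
  have hfx : h x = f x := if_neg (not_lt.mpr hx.le)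
  have hgx : g x = conv φ p x := by rw [hg, if_pos hx.le]
  simp only [hs]
  rw [hint.unique hseries, ← hgx, ← hfx]
  exact hren x
end
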